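/- Let X be a compact analytic subset of ℝⁿ (not necessarily connected). Then there exist a positive integer ν and a constant C > 0 such that any two points p, q lying in the same connected component of X can be joined by a continuous path in X (from p to q, with image contained in X) of length at most C·‖p − q‖^{1/ν}. -/

import Mathlib

/-- A set `X ⊆ ℝⁿ` is an analytic subset if each point of `ℝⁿ` has an open
neighborhood `U` on which `X ∩ U` is the common zero set of finitely many
real-analytic functions. -/
def IsAnalyticSubset {n : ℕ} (X : Set (EuclideanSpace ℝ (Fin n))) : Prop :=
  ∀ p : EuclideanSpace ℝ (Fin n),
    ∃ U : Set (EuclideanSpace ℝ (Fin n)), IsOpen U ∧ p ∈ U ∧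
      ∃ (k : ℕ) (f : Fin k → EuclideanSpace ℝ (Fin n) → ℝ),
        (∀ i, AnalyticOn ℝ (f i) U) ∧
        X ∩ U = {q ∈ U | ∀ i, f i q = 0}

namespace WR
open Set Filter Topology

section Hadamard
variable {E : Type*} [NormedAddCommGroup E] [NormedSpace ℝ E]

/-- The projection along `e` onto the kernel of `l`. -/
noncomputable def proj (l : E →L[ℝ] ℝ) (e : E) : E →L[ℝ] E :=
  ContinuousLinearMap.id ℝ E - l.smulRight e

lemma proj_apply (l : E →L[ℝ] ℝ) (e z : E) : proj l e z = z - l z • e := by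
  simp [proj]

/-- Quotient power series for the Hadamard lemma. -/
noncomputable def quotSeries (p : FormalMultilinearSeries ℝ E ℝ) (l : E →L[ℝ] ℝ) (e : E) :
    FormalMultilinearSeries ℝ E ℝ := fun k =>
  ∑ j : Fin (k + 1), ((p (k + 1)).compContinuousLinearMap
    (fun i => if i < j then ContinuousLinearMap.id ℝ E
      else if i = j then ContinuousLinearMap.id ℝ E else proj l e)).curryMid j e

lemma quotSeries_apply (p : FormalMultilinearSeries ℝ E ℝ) (l : E →L[ℝ] ℝ) (e : E) (k : ℕ)
    (z : E) : l z * quotSeries p l e k (fun _ => z) =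
      p (k + 1) (fun _ => z) - p (k + 1) (fun _ => proj l e z) := by
  have h := (p (k + 1)).toMultilinearMap.map_piecewise_sub_map_piecewise
    (fun _ => z) (fun _ => proj l e z) 0 Finset.univ
  simp only [Finset.piecewise_univ, Finset.mem_univ, if_true] at h
  refine Eq.trans ?_ h.symm
  rw [quotSeries, ContinuousMultilinearMap.sum_apply, Finset.mul_sum]
  refine Finset.sum_congr rfl fun j _ => ?_
  rw [ContinuousMultilinearMap.curryMid_apply]
  have hz : z - proj l e z = l z • e := by rw [proj_apply]; abel
  rw [ContinuousMultilinearMap.compContinuousLinearMap_apply]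
  have h1 : (fun i => if i < j then z else if i = j then z - proj l e z else proj l e z)
      = Function.update (fun i => if i < j then z else proj l e z) j (l z • e) := by
    ext i
    by_cases hij : i = j
    · subst hij; simp [hz]
    · simp [hij]
  rw [h1, MultilinearMap.map_update_smul, smul_eq_mul]
  congr 1
  refine congrArg (p (k+1)) (funext fun i => ?_)
  by_cases hij : i = j
  · subst hij; simp
  · obtain ⟨i', rfl⟩ := Fin.exists_succAbove_eq hij
    by_cases h2 : j.succAbove i' < j <;> simp [hij, h2]

lemma quotSeries_norm (p : FormalMultilinearSeries ℝ E ℝ) (l : E →L[ℝ] ℝ) (e : E) (k : ℕ) :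
    ‖quotSeries p l e k‖ ≤ (k + 1) * (‖p (k + 1)‖ * (1 + ‖proj l e‖) ^ (k + 1) * ‖e‖) := by
  refine (norm_sum_le _ _).trans ?_
  have : ∀ j ∈ (Finset.univ : Finset (Fin (k+1))), ‖((p (k + 1)).compContinuousLinearMap
    (fun i => if i < j then ContinuousLinearMap.id ℝ E
      else if i = j then ContinuousLinearMap.id ℝ E else proj l e)).curryMid j e‖ ≤
      ‖p (k + 1)‖ * (1 + ‖proj l e‖) ^ (k + 1) * ‖e‖ := by
    intro j _
    refine (ContinuousLinearMap.le_opNorm _ _).trans ?_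
    gcongr
    rw [ContinuousMultilinearMap.norm_curryMid]
    refine (ContinuousMultilinearMap.norm_compContinuousLinearMap_le _ _).trans ?_
    gcongr
    refine (Finset.prod_le_prod (fun _ _ => norm_nonneg _) (g := fun _ => 1 + ‖proj l e‖) ?_).trans ?_
    · intro i _
      have := ContinuousLinearMap.norm_id_le (𝕜 := ℝ) (E := E)
      have := norm_nonneg (proj l e)
      split_ifs <;> linarith
    · simp
  refine (Finset.sum_le_sum this).trans ?_
  simp

theorem hadamard {f : E → ℝ} (hf : AnalyticAt ℝ f 0) (l : E →L[ℝ] ℝ) (e : E) :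
    ∃ g : E → ℝ, AnalyticAt ℝ g 0 ∧ ∀ᶠ z in 𝓝 0, f z = f (proj l e z) + l z * g z := by
  obtain ⟨p, hp⟩ := hf
  have hrad : 0 < (quotSeries p l e).radius := by
    obtain ⟨C, r, hC, hr, hb⟩ := p.le_mul_pow_of_radius_pos hp.radius_pos
    set M := 1 + ‖proj l e‖ with hM
    have hMpos : 0 < M := by positivity
    let s : NNReal := ⟨(2 * r * M)⁻¹, by positivity⟩
    have hs : 0 < s := by
      change (0:ℝ) < (2 * r * M)⁻¹
      positivity
    refine lt_of_lt_of_le (ENNReal.coe_pos.2 hs)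
      (FormalMultilinearSeries.le_radius_of_bound _ (C * r * M * ‖e‖) ?_)
    intro k
    have h1 := quotSeries_norm p l e k
    have h2 : ((k:ℝ) + 1) ≤ 2 ^ k := by exact_mod_cast Nat.lt_two_pow_self (n := k)
    calc ‖quotSeries p l e k‖ * (s:ℝ) ^ k
        ≤ (2 ^ k * (C * r ^ (k+1) * M ^ (k+1) * ‖e‖)) * (s:ℝ) ^ k := by
          gcongr
          refine h1.trans ?_
          gcongr
          exact hb _
      _ = (C * r * M * ‖e‖) * ((2 * r * M) * (s:ℝ)) ^ k := by
          rw [mul_pow, mul_pow, mul_pow]; ring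
      _ = C * r * M * ‖e‖ := by
          have : (2 * r * M) * (s:ℝ) = 1 := by
            change (2 * r * M) * (2 * r * M)⁻¹ = 1
            field_simp
          rw [this]; simp
  have hq := (quotSeries p l e).hasFPowerSeriesOnBall hrad
  refine ⟨_, hq.analyticAt, ?_⟩
  obtain ⟨R, hR⟩ := hp
  have e1 : ∀ᶠ z in 𝓝 (0:E), z ∈ Metric.eball (0:E) R := Metric.eball_mem_nhds _ hR.r_pos
  have e2 : ∀ᶠ z in 𝓝 (0:E), proj l e z ∈ Metric.eball (0:E) R := by
    have : Tendsto (proj l e) (𝓝 0) (𝓝 0) := by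
      simpa using (proj l e).continuous.tendsto 0
    exact this.eventually e1
  have e3 : ∀ᶠ z in 𝓝 (0:E), z ∈ Metric.eball (0:E) (quotSeries p l e).radius :=
    Metric.eball_mem_nhds _ hrad
  filter_upwards [e1, e2, e3] with z h1 h2 h3
  have s1 := hR.hasSum h1
  have s2 := hR.hasSum h2
  have s3 := (hq.hasSum h3).mul_left (l z)
  simp only [zero_add] at s1 s2 s3
  have s4 := s1.sub s2
  rw [← hasSum_nat_add_iff' 1] at s4
  simp only [← quotSeries_apply] at s4
  have := s4.unique s3
  have h0 : p 0 (fun _ => z) = p 0 (fun _ => proj l e z) := by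
    congr 1; ext i; exact i.elim0
  simp [h0] at this
  linarith
end Hadamard

section Domain
variable {E : Type*} [NormedAddCommGroup E] [NormedSpace ℝ E]

theorem germ_domain {A B : E → ℝ} (hA : AnalyticAt ℝ A 0) (hB : AnalyticAt ℝ B 0)
    (h : ∀ᶠ x in 𝓝 0, A x * B x = 0) : (∀ᶠ x in 𝓝 0, A x = 0) ∨ (∀ᶠ x in 𝓝 0, B x = 0) := by
  by_cases hA0 : ∀ᶠ x in 𝓝 0, A x = 0
  · exact Or.inl hA0
  right
  obtain ⟨r, hr, hball⟩ := Metric.eventually_nhds_iff_ball.1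
    ((hA.eventually_analyticAt.and hB.eventually_analyticAt).and h)
  have hex : ∃ x ∈ Metric.ball (0:E) r, A x ≠ 0 := by
    by_contra hcon
    push Not at hcon
    exact hA0 (Filter.eventually_of_mem (Metric.ball_mem_nhds _ hr) hcon)
  obtain ⟨x0, hx0, hAx⟩ := hex
  have hBon : AnalyticOnNhd ℝ B (Metric.ball 0 r) := fun x hx => (hball x hx).1.2
  have hBx : B =ᶠ[𝓝 x0] 0 := by
    filter_upwards [(hball x0 hx0).1.1.continuousAt.eventually_ne hAx,
      Metric.isOpen_ball.mem_nhds hx0] with x h1 h2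
    have := (hball x h2).2
    simpa [h1] using this
  have := hBon.eqOn_zero_of_preconnected_of_eventuallyEq_zero
    (convex_ball _ _).isPreconnected hx0 hBx
  exact Filter.eventually_of_mem (Metric.ball_mem_nhds _ hr) this

/-- Cancellation in the ring of germs. -/
theorem germ_cancel {A B C : E → ℝ} (hA : AnalyticAt ℝ A 0) (hB : AnalyticAt ℝ B 0)
    (hC : AnalyticAt ℝ C 0)
    (hA0 : ¬ ∀ᶠ x in 𝓝 0, A x = 0) (h : ∀ᶠ x in 𝓝 0, A x * B x = A x * C x) :
    ∀ᶠ x in 𝓝 0, B x = C x := by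
  rcases germ_domain hA (hB.sub hC) (by
    filter_upwards [h] with x hx
    simp only [Pi.sub_apply, mul_sub]; linarith) with h1 | h1
  · exact absurd h1 hA0
  · filter_upwards [h1] with x hx
    simpa [sub_eq_zero] using hx

theorem germ_prod_ne {ι : Type*} (s : Finset ι) (A : ι → E → ℝ)
    (hA : ∀ i ∈ s, AnalyticAt ℝ (A i) 0) (h0 : ∀ i ∈ s, ¬ ∀ᶠ x in 𝓝 0, A i x = 0) :
    ¬ ∀ᶠ x in 𝓝 0, ∏ i ∈ s, A i x = 0 := by
  classical
  induction s using Finset.induction_on with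
  | empty => simpa using (inferInstance : (𝓝 (0:E)).NeBot).ne
  | insert i s his ih =>
    intro hcon
    simp only [Finset.prod_insert his] at hcon
    rcases germ_domain (hA i (by simp)) (Finset.analyticAt_fun_prod _
      fun j hj => hA j (Finset.mem_insert_of_mem hj)) hcon with h1 | h1
    · exact h0 i (by simp) h1
    · exact ih (fun j hj => hA j (Finset.mem_insert_of_mem hj))
        (fun j hj => h0 j (Finset.mem_insert_of_mem hj)) h1
end Domain

end WR

namespace WR
open Set Filter Topology

/-- The monomial with exponent `α`. -/
def mon {n : ℕ} (α : Fin n → ℕ) (x : Fin n → ℝ) : ℝ := ∏ i, x i ^ α i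

/-- Normal crossings germ: monomial times a unit. -/
def NC {n : ℕ} (f : (Fin n → ℝ) → ℝ) : Prop :=
  ∃ (α : Fin n → ℕ) (u : (Fin n → ℝ) → ℝ), AnalyticAt ℝ u 0 ∧ u 0 ≠ 0 ∧
    ∀ᶠ x in 𝓝 0, f x = mon α x * u x

section mon
variable {n : ℕ}

lemma mon_add (α β : Fin n → ℕ) (x : Fin n → ℝ) : mon (α + β) x = mon α x * mon β x := by
  simp [mon, pow_add, Finset.prod_mul_distrib]

lemma mon_zero (x : Fin n → ℝ) : mon 0 x = 1 := by simp [mon]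

lemma mon_single (i : Fin n) (k : ℕ) (x : Fin n → ℝ) : mon (Pi.single i k) x = x i ^ k := by
  unfold mon
  rw [Finset.prod_eq_single i]
  · simp
  · intro j _ hj; simp [hj]
  · simp

lemma mon_smul (k : ℕ) (α : Fin n → ℕ) (x : Fin n → ℝ) : mon (k • α) x = mon α x ^ k := by
  simp [mon, ← Finset.prod_pow, pow_mul, mul_comm k]

lemma mon_analytic (α : Fin n → ℕ) (x : Fin n → ℝ) : AnalyticAt ℝ (mon α) x := by
  unfold mon
  refine Finset.analyticAt_fun_prod _ fun i _ => ?_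
  exact ((ContinuousLinearMap.proj (R := ℝ) (φ := fun _ : Fin n => ℝ) i).analyticAt x).pow _

lemma mon_ne_zero (α : Fin n → ℕ) {x : Fin n → ℝ} (hx : ∀ i, x i ≠ 0) : mon α x ≠ 0 :=
  Finset.prod_ne_zero_iff.2 fun i _ => pow_ne_zero _ (hx i)

lemma mon_eq_zero {α : Fin n → ℕ} {x : Fin n → ℝ} {i : Fin n} (hi : α i ≠ 0) (hx : x i = 0) :
    mon α x = 0 :=
  Finset.prod_eq_zero (Finset.mem_univ i) (by simp [hx, hi])

lemma exists_of_mon_zero {α : Fin n → ℕ} (h : mon α 0 = 0) : ∃ i, α i ≠ 0 := by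
  obtain ⟨i, _, hi⟩ := Finset.prod_eq_zero_iff.1 h
  refine ⟨i, fun h0 => ?_⟩
  simp [h0] at hi

lemma tendsto_diag : Tendsto (fun t : ℝ => (fun _ : Fin n => t)) (𝓝[≠] 0) (𝓝 0) := by
  have : Continuous (fun t : ℝ => (fun _ : Fin n => t)) := by fun_prop
  exact (this.tendsto 0).mono_left nhdsWithin_le_nhds

lemma mon_germ_ne (α : Fin n → ℕ) : ¬ ∀ᶠ x in 𝓝 0, mon α x = 0 := by
  intro h
  obtain ⟨t, ht, ht0⟩ := ((tendsto_diag.eventually h).and self_mem_nhdsWithin).exists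
  exact mon_ne_zero α (fun i => ht0) ht

lemma mon_split {α : Fin n → ℕ} {i : Fin n} (hi : α i ≠ 0) :
    ∃ β : Fin n → ℕ, α = β + Pi.single i 1 := by
  refine ⟨α - Pi.single i 1, (tsub_add_cancel_of_le ?_).symm⟩
  intro j
  by_cases h : j = i
  · subst h; simp; omega
  · simp [h]

/-- projection setting coordinate `i` to zero -/
noncomputable def P0 (i : Fin n) : (Fin n → ℝ) →L[ℝ] (Fin n → ℝ) :=
  proj (ContinuousLinearMap.proj i) (Pi.single i 1)

lemma P0_same (i : Fin n) (x : Fin n → ℝ) : P0 i x i = 0 := by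
  simp [P0, proj_apply]

lemma P0_ne {i j : Fin n} (h : j ≠ i) (x : Fin n → ℝ) : P0 i x j = x j := by
  simp [P0, proj_apply, h]

lemma P0_tendsto (i : Fin n) : Tendsto (P0 i) (𝓝 0) (𝓝 0) := by
  simpa using (P0 i).continuous.tendsto 0

lemma P0_analytic (i : Fin n) {A : (Fin n → ℝ) → ℝ} (hA : AnalyticAt ℝ A 0) :
    AnalyticAt ℝ (fun x => A (P0 i x)) 0 :=
  AnalyticAt.fun_comp (by simpa using hA) ((P0 i).analyticAt 0)

lemma coord_analytic (i : Fin n) (a : Fin n → ℝ) : AnalyticAt ℝ (fun x : Fin n → ℝ => x i) a :=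
  (ContinuousLinearMap.proj (R := ℝ) (φ := fun _ : Fin n => ℝ) i).analyticAt a

lemma coord_germ_ne (i : Fin n) : ¬ ∀ᶠ x : Fin n → ℝ in 𝓝 0, x i = 0 := by
  have := mon_germ_ne (Pi.single i 1)
  simpa [mon_single] using this

lemma coord_div {A : (Fin n → ℝ) → ℝ} (hA : AnalyticAt ℝ A 0) (i : Fin n)
    (h : ∀ᶠ x in 𝓝 0, A (P0 i x) = 0) :
    ∃ B, AnalyticAt ℝ B 0 ∧ ∀ᶠ x in 𝓝 0, A x = x i * B x := by
  obtain ⟨g, hg, hgz⟩ := hadamard hA (ContinuousLinearMap.proj i) (Pi.single i 1)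
  refine ⟨g, hg, ?_⟩
  filter_upwards [h, hgz] with x h1 h2
  rw [h2]
  change A (P0 i x) + _ = _
  rw [h1]; simp

lemma NC.congr {f g : (Fin n → ℝ) → ℝ} (h : NC f) (hfg : f =ᶠ[𝓝 0] g) : NC g := by
  obtain ⟨α, u, hu, hu0, he⟩ := h
  refine ⟨α, u, hu, hu0, ?_⟩
  filter_upwards [he, hfg] with x h1 h2
  rw [← h2, h1]

lemma NC.ne {f : (Fin n → ℝ) → ℝ} (h : NC f) : ¬ ∀ᶠ x in 𝓝 0, f x = 0 := by
  obtain ⟨α, u, hu, hu0, he⟩ := h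
  intro h0
  apply mon_germ_ne α
  filter_upwards [he, h0, hu.continuousAt.eventually_ne hu0] with x h1 h2 h3
  rw [h2] at h1
  have := h1.symm
  simpa [h3] using this

lemma NC.coord_mul {B : (Fin n → ℝ) → ℝ} (h : NC B) (i : Fin n) : NC (fun x => x i * B x) := by
  obtain ⟨α, u, hu, hu0, he⟩ := h
  refine ⟨α + Pi.single i 1, u, hu, hu0, ?_⟩
  filter_upwards [he] with x hx
  rw [hx, mon_add, mon_single]; ring

lemma factor_aux (N : ℕ) : ∀ (α : Fin n → ℕ), ∑ i, α i = N → ∀ (A B u : (Fin n → ℝ) → ℝ),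
    AnalyticAt ℝ A 0 → AnalyticAt ℝ B 0 → AnalyticAt ℝ u 0 → u 0 ≠ 0 →
    (∀ᶠ x in 𝓝 0, A x * B x = mon α x * u x) → NC A := by
  induction N with
  | zero =>
    intro α hα A B u hA hB hu hu0 h
    have hα0 : α = 0 := by
      ext i
      have := (Finset.sum_eq_zero_iff.1 hα) i (Finset.mem_univ i)
      simpa using this
    subst hα0
    refine ⟨0, A, hA, fun h0 => hu0 ?_, by simp [mon_zero]⟩
    have := h.self_of_nhds
    rw [h0, mon_zero] at this
    linarith
  | succ N ih =>
    intro α hα A B u hA hB hu hu0 h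
    have hex : ∃ i, α i ≠ 0 := by
      by_contra hcon
      push Not at hcon
      simp [hcon] at hα
    obtain ⟨i, hi⟩ := hex
    obtain ⟨β, rfl⟩ := mon_split hi
    have hβ : ∑ j, β j = N := by
      have : ∑ j, (β + Pi.single i 1 : Fin n → ℕ) j = ∑ j, β j + 1 := by
        simp [Finset.sum_add_distrib]
      omega
    have h0 : ∀ᶠ x in 𝓝 0, A (P0 i x) * B (P0 i x) = 0 := by
      filter_upwards [(P0_tendsto i).eventually h] with x hx
      rw [hx, mon_eq_zero hi (P0_same i x), zero_mul]
    rcases germ_domain (P0_analytic i hA) (P0_analytic i hB) h0 with h1 | h1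
    · obtain ⟨A', hA', hAe⟩ := coord_div hA i h1
      have h2 : ∀ᶠ x in 𝓝 0, A' x * B x = mon β x * u x := by
        refine germ_cancel (coord_analytic i 0) (hA'.mul hB) ((mon_analytic β 0).mul hu)
          (coord_germ_ne i) ?_
        filter_upwards [h, hAe] with x hx1 hx2
        rw [hx2, mon_add, mon_single] at hx1
        try simp only [Pi.mul_apply]
        linarith
      have := ih β hβ A' B u hA' hB hu hu0 h2
      refine (this.coord_mul i).congr ?_
      filter_upwards [hAe] with x hx using hx.symm
    · obtain ⟨B', hB', hBe⟩ := coord_div hB i h1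
      have h2 : ∀ᶠ x in 𝓝 0, A x * B' x = mon β x * u x := by
        refine germ_cancel (coord_analytic i 0) (hA.mul hB') ((mon_analytic β 0).mul hu)
          (coord_germ_ne i) ?_
        filter_upwards [h, hBe] with x hx1 hx2
        rw [hx2, mon_add, mon_single] at hx1
        try simp only [Pi.mul_apply]
        linarith
      exact ih β hβ A B' u hA hB' hu hu0 h2

theorem NC.factor {h A B : (Fin n → ℝ) → ℝ} (hh : NC h) (hA : AnalyticAt ℝ A 0)
    (hB : AnalyticAt ℝ B 0) (he : ∀ᶠ x in 𝓝 0, h x = A x * B x) : NC A := by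
  obtain ⟨α, u, hu, hu0, hau⟩ := hh
  refine factor_aux _ α rfl A B u hA hB hu hu0 ?_
  filter_upwards [he, hau] with x h1 h2
  rw [← h1, h2]

lemma comp_contra {a b : Fin n → ℕ} (hd : ∀ l, a l = 0 ∨ b l = 0) {i k : Fin n} (hi : a i = 0)
    (hk : b k ≠ 0) {u v : (Fin n → ℝ) → ℝ} (hu : AnalyticAt ℝ u 0) (hu0 : u 0 ≠ 0)
    (h : ∀ᶠ x in 𝓝 0, mon a (P0 i x) * u (P0 i x) - mon b (P0 i x) * v (P0 i x) = 0) : False := by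
  let X : ℝ → (Fin n → ℝ) := fun t l => if b l = 0 then t else 0
  have hX : Tendsto X (𝓝[≠] 0) (𝓝 0) := by
    have hc : Continuous X := by
      refine continuous_pi fun l => ?_
      by_cases hl : b l = 0
      · simpa [X, hl] using continuous_id'
      · simpa [X, hl] using continuous_const
    have h0 : X 0 = 0 := by ext l; simp [X]
    have := (hc.tendsto 0).mono_left (nhdsWithin_le_nhds (s := {0}ᶜ))
    rwa [h0] at this
  have hu' : ∀ᶠ x in 𝓝 0, u (P0 i x) ≠ 0 :=
    (P0_tendsto i).eventually (hu.continuousAt.eventually_ne hu0)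
  obtain ⟨t, ⟨ht1, ht2⟩, ht0⟩ :=
    ((hX.eventually (h.and hu')).and self_mem_nhdsWithin).exists
  have hb : mon b (P0 i (X t)) = 0 := by
    refine mon_eq_zero hk ?_
    by_cases hki : k = i
    · subst hki; exact P0_same _ _
    · rw [P0_ne hki]; simp [X, hk]
  have ha : mon a (P0 i (X t)) ≠ 0 := by
    refine Finset.prod_ne_zero_iff.2 fun l _ => ?_
    by_cases hl : a l = 0
    · simp [hl]
    · have hli : l ≠ i := by rintro rfl; exact hl hi
      rw [P0_ne hli]
      have : b l = 0 := (hd l).resolve_left hl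
      simp only [X, this, if_true]
      exact pow_ne_zero _ ht0
  rw [hb] at ht1
  simp [ha, ht2] at ht1

theorem comparable {a b : Fin n → ℕ} {u v : (Fin n → ℝ) → ℝ} (hu : AnalyticAt ℝ u 0)
    (hu0 : u 0 ≠ 0) (hv : AnalyticAt ℝ v 0) (hv0 : v 0 ≠ 0)
    (hD : (∀ᶠ x in 𝓝 0, mon a x * u x - mon b x * v x = 0) ∨
      NC (fun x => mon a x * u x - mon b x * v x)) : a ≤ b ∨ b ≤ a := by
  by_contra hcon
  push Not at hcon
  obtain ⟨h1, h2⟩ := hcon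
  rw [Pi.le_def] at h1 h2
  push Not at h1 h2
  obtain ⟨j, hj⟩ := h1
  obtain ⟨k, hk⟩ := h2
  set m := a ⊓ b with hm
  set a' := a - m with ha'
  set b' := b - m with hb'
  have ea : a = m + a' := (add_tsub_cancel_of_le inf_le_left).symm
  have eb : b = m + b' := (add_tsub_cancel_of_le inf_le_right).symm
  have hd : ∀ l, a' l = 0 ∨ b' l = 0 := by
    intro l; simp [ha', hb', hm]; omega
  have haj : a' j ≠ 0 := by simp [ha', hm]; omega
  have hbk : b' k ≠ 0 := by simp [hb', hm]; omega
  set G : (Fin n → ℝ) → ℝ := fun x => mon a' x * u x - mon b' x * v x with hG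
  have hGa : AnalyticAt ℝ G 0 := ((mon_analytic a' 0).mul hu).sub ((mon_analytic b' 0).mul hv)
  have hDG : ∀ x, mon a x * u x - mon b x * v x = mon m x * G x := by
    intro x; rw [ea, eb, mon_add, mon_add]; simp only [hG]; ring
  have key : ∃ i, ∀ᶠ x in 𝓝 0, G (P0 i x) = 0 := by
    rcases hD with hD | hD
    · simp only [hDG] at hD
      rcases germ_domain (mon_analytic m 0) hGa hD with h | h
      · exact absurd h (mon_germ_ne m)
      · exact ⟨j, (P0_tendsto j).eventually h⟩
    · have hNG : NC G := by
        refine hD.factor hGa (mon_analytic m 0) (Eventually.of_forall fun x => ?_)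
        rw [hDG]; ring
      obtain ⟨c, w, hw, hw0, he⟩ := hNG
      have hG0 : G 0 = 0 := by
        simp [hG, mon_eq_zero haj (x := 0) rfl, mon_eq_zero hbk (x := 0) rfl]
      have h0 := he.self_of_nhds
      rw [hG0] at h0
      have h0' : mon c 0 = 0 := by
        have := h0.symm
        simpa [hw0] using this
      obtain ⟨i, hi⟩ := exists_of_mon_zero h0'
      refine ⟨i, ?_⟩
      filter_upwards [(P0_tendsto i).eventually he] with x hx
      rw [hx, mon_eq_zero hi (P0_same i x), zero_mul]
  obtain ⟨i, hi⟩ := key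
  rcases hd i with h | h
  · exact comp_contra hd h hbk hu hu0 hi
  · refine comp_contra (fun l => (hd l).symm) h haj hv hv0 (v := u) ?_
    filter_upwards [hi] with x hx
    simp only [hG] at hx
    linarith

end mon
end WR

namespace WR
open Set Filter Topology
set_option linter.unusedSectionVars false

section CoverSec
variable {E : Type*} [NormedAddCommGroup E] [NormedSpace ℝ E]
variable {F : Type*} [NormedAddCommGroup F] [NormedSpace ℝ F]

/-- A family of germs of maps at `0` such that any choice of neighbourhoods contains finitely many
whose images cover a neighbourhood of `0`. -/
def Cover (S : Set (E → E)) : Prop :=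
  ∀ N : (E → E) → Set E, (∀ π ∈ S, N π ∈ 𝓝 0) →
    ∃ T ⊆ S, T.Finite ∧ (⋃ π ∈ T, π '' N π) ∈ 𝓝 0

/-- Germs that become of type `B` after finitely many covering families of analytic maps. -/
inductive Res (B : (E → ℝ) → Prop) : (E → ℝ) → Prop
  | base (f : E → ℝ) (h : B f) : Res B f
  | step (f : E → ℝ) (S : Set (E → E)) (hS : Cover S)
      (ha : ∀ π ∈ S, AnalyticAt ℝ π 0 ∧ π 0 = 0) (h : ∀ π ∈ S, Res B (f ∘ π)) : Res B f

lemma tendsto_zero {π : E → F} (h : AnalyticAt ℝ π 0) (h0 : π 0 = 0) : Tendsto π (𝓝 0) (𝓝 0) := by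
  have := h.continuousAt.tendsto
  rwa [h0] at this

theorem Res.congr {B : (E → ℝ) → Prop} (hB : ∀ f g, f =ᶠ[𝓝 0] g → B f → B g) {f g : E → ℝ}
    (hf : Res B f) (hfg : f =ᶠ[𝓝 0] g) : Res B g := by
  induction hf generalizing g with
  | base f h => exact Res.base _ (hB _ _ hfg h)
  | step f S hS ha h ih =>
    refine Res.step _ S hS ha fun π hπ => ih π hπ ?_
    exact (tendsto_zero (ha π hπ).1 (ha π hπ).2).eventually hfg

lemma cover_single {σ τ : E → E} (hτ : ContinuousAt τ 0) (hτ0 : τ 0 = 0)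
    (h : ∀ᶠ z in 𝓝 0, σ (τ z) = z) : Cover {σ} := by
  intro N hN
  refine ⟨{σ}, Subset.rfl, finite_singleton _, ?_⟩
  have h1 : Tendsto τ (𝓝 0) (𝓝 0) := by
    have := hτ.tendsto
    rwa [hτ0] at this
  filter_upwards [h, h1 (hN σ rfl)] with z hz1 hz2
  simp only [mem_singleton_iff, iUnion_iUnion_eq_left]
  exact ⟨τ z, hz2, hz1⟩

theorem Res.of_single {B : (E → ℝ) → Prop} {f : E → ℝ} {σ τ : E → E} (hσ : AnalyticAt ℝ σ 0)
    (hσ0 : σ 0 = 0) (hτ : ContinuousAt τ 0) (hτ0 : τ 0 = 0)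
    (h : ∀ᶠ z in 𝓝 0, σ (τ z) = z) (hR : Res B (f ∘ σ)) : Res B f := by
  refine Res.step f {σ} (cover_single hτ hτ0 h) ?_ ?_
  · rintro π rfl; exact ⟨hσ, hσ0⟩
  · rintro π rfl; exact hR

lemma cover_lift {S : Set (E → E)} (hS : Cover S) :
    Cover ((fun π : E → E => (Prod.map π id : E × ℝ → E × ℝ)) '' S) := by
  intro N hN
  have h1 : ∀ π : E → E, ∃ N1 N2, π ∈ S → (N1 ∈ 𝓝 (0:E) ∧ N2 ∈ 𝓝 (0:ℝ) ∧
      N1 ×ˢ N2 ⊆ N (Prod.map π id)) := by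
    intro π
    by_cases hπ : π ∈ S
    · have := hN _ (mem_image_of_mem _ hπ)
      rw [Prod.zero_eq_mk, mem_nhds_prod_iff] at this
      obtain ⟨u, hu, v, hv, h⟩ := this
      exact ⟨u, v, fun _ => ⟨hu, hv, h⟩⟩
    · exact ⟨univ, univ, fun h => absurd h hπ⟩
  choose N1 N2 h12 using h1
  obtain ⟨T, hTS, hTf, hT⟩ := hS N1 fun π hπ => (h12 π hπ).1
  refine ⟨_, image_mono hTS, hTf.image _, ?_⟩
  have h2 : (⋂ π ∈ T, N2 π) ∈ 𝓝 (0:ℝ) := (biInter_mem hTf).2 fun π hπ => (h12 π (hTS hπ)).2.1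
  rw [Prod.zero_eq_mk]
  refine mem_of_superset (prod_mem_nhds hT h2) ?_
  rintro ⟨x, y⟩ ⟨hx, hy⟩
  simp only [mem_iUnion, mem_iInter] at hx hy
  obtain ⟨π, hπ, x', hx', rfl⟩ := hx
  simp only [mem_iUnion]
  refine ⟨Prod.map π id, mem_image_of_mem _ hπ, (x', y), ?_, rfl⟩
  exact (h12 π (hTS hπ)).2.2 ⟨hx', hy π hπ⟩

lemma map_analytic {π : E → E} (h : AnalyticAt ℝ π 0) :
    AnalyticAt ℝ (Prod.map π id : E × ℝ → E × ℝ) 0 := by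
  have h1 : AnalyticAt ℝ (fun z : E × ℝ => π z.1) 0 :=
    AnalyticAt.fun_comp (f := fun z : E × ℝ => z.1) (by simpa using h) analyticAt_fst
  exact h1.prod analyticAt_snd

theorem Res.lift_step {B' : (E × ℝ → ℝ) → Prop} {G : E × ℝ → ℝ}
    {S : Set (E → E)} (hS : Cover S) (ha : ∀ π ∈ S, AnalyticAt ℝ π 0 ∧ π 0 = 0)
    (h : ∀ π ∈ S, Res B' (G ∘ Prod.map π id)) : Res B' G := by
  refine Res.step G _ (cover_lift hS) ?_ ?_
  · rintro _ ⟨π, hπ, rfl⟩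
    exact ⟨map_analytic (ha π hπ).1, by simp [Prod.map, (ha π hπ).2]⟩
  · rintro _ ⟨π, hπ, rfl⟩
    exact h π hπ

theorem Res.lift {B : (E → ℝ) → Prop} {B' : (E × ℝ → ℝ) → Prop} {h : E → ℝ} (hR : Res B h) :
    ∀ G : E × ℝ → ℝ, (∀ π : E → E, AnalyticAt ℝ π 0 → π 0 = 0 → B (h ∘ π) →
      Res B' (G ∘ Prod.map π id)) → Res B' G := by
  induction hR with
  | base f hf =>
    intro G hG
    have := hG id analyticAt_id rfl hf
    simpa using this
  | step f S hS ha h ih =>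
    intro G hG
    refine Res.lift_step hS ha fun π hπ => ih π hπ _ fun ρ hρ hρ0 hB => ?_
    have := hG (π ∘ ρ) (AnalyticAt.comp (by rw [hρ0]; exact (ha π hπ).1) hρ)
      (by simp [hρ0, (ha π hπ).2]) hB
    have e : (Prod.map (π ∘ ρ) id : E × ℝ → E × ℝ) = Prod.map π id ∘ Prod.map ρ id := by
      rw [Prod.map_comp_map]; rfl
    rw [e, ← Function.comp_assoc] at this
    exact this

theorem Res.transport {B : (F → ℝ) → Prop} {B' : (E → ℝ) → Prop} (e : E ≃L[ℝ] F)
    (hBB : ∀ f, B f → B' (f ∘ e)) {f : F → ℝ} (hR : Res B f) : Res B' (f ∘ e) := by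
  induction hR with
  | base f hf => exact Res.base _ (hBB _ hf)
  | step f S hS ha h ih =>
    let c : (F → F) → (E → E) := fun π => e.symm ∘ π ∘ e
    refine Res.step _ (c '' S) ?_ ?_ ?_
    · intro N hN
      have hN' : ∀ π ∈ S, e.symm ⁻¹' (N (c π)) ∈ 𝓝 0 := by
        intro π hπ
        have := e.symm.continuous.continuousAt (x := 0)
        refine this.preimage_mem_nhds ?_
        simpa using hN _ (mem_image_of_mem c hπ)
      obtain ⟨T, hTS, hTf, hT⟩ := hS _ hN'
      refine ⟨c '' T, image_mono hTS, hTf.image _, ?_⟩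
      have h2 : e ⁻¹' (⋃ π ∈ T, π '' (e.symm ⁻¹' (N (c π)))) ∈ 𝓝 0 :=
        e.continuous.continuousAt.preimage_mem_nhds (by simpa using hT)
      refine mem_of_superset h2 ?_
      intro x hx
      simp only [mem_preimage, mem_iUnion] at hx
      obtain ⟨π, hπ, z, hz, hzx⟩ := hx
      simp only [mem_iUnion]
      refine ⟨c π, mem_image_of_mem _ hπ, e.symm z, hz, ?_⟩
      simp [c, hzx]
    · rintro _ ⟨π, hπ, rfl⟩
      refine ⟨?_, by simp [c, (ha π hπ).2]⟩
      refine (e.symm.analyticAt _).comp (AnalyticAt.comp ?_ (e.analyticAt 0))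
      simpa using (ha π hπ).1
    · rintro _ ⟨π, hπ, rfl⟩
      have := ih π hπ
      convert this using 1
      ext x; simp [c]
end CoverSec

section Blow
variable {n : ℕ}

/-- First chart of the blow-up of `{x_i = y = 0}`. -/
def blA (i : Fin n) (z : (Fin n → ℝ) × ℝ) : (Fin n → ℝ) × ℝ :=
  (Function.update z.1 i (z.1 i * z.2), z.2)

/-- Second chart of the blow-up of `{x_i = y = 0}`, centred at `v`. -/
def blB (i : Fin n) (v : ℝ) (z : (Fin n → ℝ) × ℝ) : (Fin n → ℝ) × ℝ :=
  (z.1, z.1 i * (z.2 + v))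

lemma fst_coord_analytic (i : Fin n) (a : (Fin n → ℝ) × ℝ) :
    AnalyticAt ℝ (fun z : (Fin n → ℝ) × ℝ => z.1 i) a :=
  AnalyticAt.fun_comp (g := fun x : Fin n → ℝ => x i) (f := fun z : (Fin n → ℝ) × ℝ => z.1)
    (coord_analytic i _) analyticAt_fst

lemma blA_analytic (i : Fin n) (a) : AnalyticAt ℝ (blA i) a := by
  refine AnalyticAt.prod ?_ analyticAt_snd
  rw [analyticAt_pi_iff]
  intro j
  by_cases hj : j = i
  · subst hj
    simpa using (fst_coord_analytic j a).fun_mul analyticAt_snd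
  · simpa [hj] using fst_coord_analytic j a

lemma blB_analytic (i : Fin n) (v) (a) : AnalyticAt ℝ (blB i v) a :=
  AnalyticAt.prod analyticAt_fst ((fst_coord_analytic i a).mul (analyticAt_snd.add analyticAt_const))

lemma blA_zero (i : Fin n) : blA i 0 = 0 := by
  simp [blA]

lemma blB_zero (i : Fin n) (v) : blB i v 0 = 0 := by
  simp [blB]

theorem cover_blow (i : Fin n) : Cover (insert (blA i) (range (blB i))) := by
  intro N hN
  have hball : ∀ {s : Set ((Fin n → ℝ) × ℝ)}, s ∈ 𝓝 0 → ∃ r > 0, ∀ x y, ‖x‖ < r → |y| < r →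
      (x, y) ∈ s := by
    intro s hs
    obtain ⟨r, hr, h⟩ := Metric.mem_nhds_iff.1 hs
    refine ⟨r, hr, fun x y hx hy => h ?_⟩
    simp [Prod.norm_def, hx, hy]
  obtain ⟨ε, hε, hA⟩ := hball (hN _ (mem_insert _ _))
  have hBex : ∀ v : ℝ, ∃ r > 0, ∀ x y, ‖x‖ < r → |y| < r → (x, y) ∈ N (blB i v) :=
    fun v => hball (hN _ (mem_insert_of_mem _ (mem_range_self v)))
  choose r hr hB using hBex
  obtain ⟨t, ht, hcov⟩ := (isCompact_Icc (a := -(2/ε)) (b := 2/ε)).elim_nhds_subcover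
    (fun v => Metric.ball v (r v)) (fun v _ => Metric.ball_mem_nhds _ (hr v))
  have hrmin : ∃ ρ > 0, ∀ v ∈ t, ρ ≤ r v := by
    by_cases hne : t.Nonempty
    · exact ⟨t.inf' hne r, by simpa [Finset.lt_inf'_iff] using fun v _ => hr v,
        fun v hv => Finset.inf'_le _ hv⟩
    · refine ⟨1, one_pos, fun v hv => absurd ⟨v, hv⟩ hne⟩
  obtain ⟨ρ, hρ, hρr⟩ := hrmin
  refine ⟨insert (blA i) (blB i '' t), ?_, (t.finite_toSet.image _).insert _, ?_⟩
  · exact insert_subset_insert (image_subset_range _ _)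
  refine Metric.mem_nhds_iff.2 ⟨min ρ ε, lt_min hρ hε, ?_⟩
  rintro ⟨x, y⟩ hxy
  have hxy' : ‖x‖ < min ρ ε ∧ |y| < min ρ ε := by
    have h3 : max ‖x‖ ‖y‖ < min ρ ε := by simpa only [mem_ball_zero_iff, Prod.norm_def] using hxy
    exact ⟨lt_of_le_of_lt (le_max_left _ _) h3, lt_of_le_of_lt (le_max_right _ _) h3⟩
  obtain ⟨hx, hy⟩ := hxy'
  have hx1 := lt_of_lt_of_le hx (min_le_left _ _)
  have hx2 := lt_of_lt_of_le hx (min_le_right _ _)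
  have hy2 := lt_of_lt_of_le hy (min_le_right _ _)
  simp only [mem_iUnion]
  have hxi : |x i| ≤ ‖x‖ := norm_le_pi_norm x i
  by_cases hc : |x i| ≤ ε / 2 * |y|
  · refine ⟨blA i, mem_insert _ _, (Function.update x i (x i / y), y), hA _ _ ?_ hy2, ?_⟩
    · rw [pi_norm_lt_iff hε]
      intro j
      by_cases hj : j = i
      · subst hj
        simp only [Function.update_self]
        by_cases hy0 : y = 0
        · simp [hy0, hε]
        · rw [Real.norm_eq_abs, abs_div, div_lt_iff₀ (abs_pos.2 hy0)]
          have := abs_pos.2 hy0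
          nlinarith
      · simp only [Function.update_of_ne hj]
        exact lt_of_le_of_lt (norm_le_pi_norm x j) hx2
    · simp only [blA, Function.update_self, Function.update_idem]
      congr 1
      by_cases hy0 : y = 0
      · have : x i = 0 := by simpa [hy0] using hc
        subst hy0
        simp [← this]
      · rw [div_mul_cancel₀ _ hy0]; simp
  · push Not at hc
    have hx0 : x i ≠ 0 := by
      intro h
      rw [h, abs_zero] at hc
      have : 0 ≤ ε / 2 * |y| := by positivity
      linarith
    have hv : y / x i ∈ Icc (-(2/ε)) (2/ε) := by
      rw [mem_Icc, ← abs_le, abs_div, div_le_div_iff₀ (abs_pos.2 hx0) hε]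
      nlinarith
    have := hcov hv
    simp only [mem_iUnion] at this
    obtain ⟨v, hvt, hvb⟩ := this
    refine ⟨blB i v, mem_insert_of_mem _ (mem_image_of_mem _ hvt), (x, y / x i - v),
      hB v _ _ (lt_of_lt_of_le hx1 (hρr v hvt)) ?_, ?_⟩
    · simpa [Real.dist_eq] using hvb
    · simp only [blB]
      congr 1
      field_simp
      ring

/-- Power substitution with signs. -/
def pw (N : ℕ) (s : Fin n → ℝ) (x : Fin n → ℝ) : Fin n → ℝ := fun i => s i * x i ^ N

lemma pw_analytic (N : ℕ) (s : Fin n → ℝ) (a) : AnalyticAt ℝ (pw N s) a := by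
  rw [analyticAt_pi_iff]
  intro i
  exact analyticAt_const.mul ((coord_analytic i a).pow N)

lemma pw_zero {N : ℕ} (hN : N ≠ 0) (s : Fin n → ℝ) : pw N s 0 = 0 := by
  ext i; simp [pw, hN]

theorem cover_pw {N : ℕ} (hN : N ≠ 0) :
    Cover (pw N '' {s : Fin n → ℝ | ∀ i, s i = 1 ∨ s i = -1}) := by
  have hfin : {s : Fin n → ℝ | ∀ i, s i = 1 ∨ s i = -1}.Finite := by
    have := Set.Finite.pi' (fun _ : Fin n => (Set.toFinite ({1, -1} : Set ℝ)))
    simpa using this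
  intro M hM
  refine ⟨_, Subset.rfl, hfin.image _, ?_⟩
  have h1 : (⋂ s ∈ {s : Fin n → ℝ | ∀ i, s i = 1 ∨ s i = -1}, M (pw N s)) ∈ 𝓝 (0 : Fin n → ℝ) :=
    (biInter_mem hfin).2 fun s hs => hM _ (mem_image_of_mem _ hs)
  let R : (Fin n → ℝ) → (Fin n → ℝ) := fun z i => |z i| ^ ((N:ℝ)⁻¹)
  have hR : Tendsto R (𝓝 0) (𝓝 0) := by
    have hNp : (N:ℝ)⁻¹ ≠ 0 := by positivity
    have hc : Continuous R := by
      refine continuous_pi fun i => ?_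
      exact (continuous_abs.comp (continuous_apply i)).rpow_const fun _ => Or.inr (by positivity)
    have h0 : R 0 = 0 := by ext i; simp [R, hN]
    have := hc.tendsto 0
    rwa [h0] at this
  filter_upwards [hR h1] with z hz
  simp only [mem_preimage, mem_iInter] at hz
  simp only [mem_iUnion]
  let s : Fin n → ℝ := fun i => if 0 ≤ z i then 1 else -1
  have hs : s ∈ {s : Fin n → ℝ | ∀ i, s i = 1 ∨ s i = -1} := by
    intro i
    by_cases h : 0 ≤ z i <;> simp [s, h]
  refine ⟨pw N s, mem_image_of_mem _ hs, R z, hz s hs, ?_⟩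
  ext i
  simp only [pw, R]
  rw [Real.rpow_inv_natCast_pow (abs_nonneg _) hN]
  by_cases h : 0 ≤ z i
  · simp [s, h, abs_of_nonneg h]
  · simp [s, h, abs_of_neg (not_le.1 h)]

end Blow
end WR

namespace WR
open Set Filter Topology
set_option linter.unusedSectionVars false

section Taylor

theorem iteratedDeriv_mul_id {φ g : ℝ → ℝ} {c : ℝ} (hg : AnalyticAt ℝ g 0)
    (h : ∀ᶠ t in 𝓝 0, φ t = c + t * g t) (k : ℕ) :
    iteratedDeriv (k + 1) φ 0 = (k + 1) * iteratedDeriv k g 0 := by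
  have h' : φ =ᶠ[𝓝 0] fun t => c + t * g t := h
  rw [h'.iteratedDeriv_eq, iteratedDeriv_const_add (Nat.succ_pos k),
    iteratedDeriv_fun_mul contDiffAt_fun_id hg.contDiffAt, Finset.sum_eq_single 1]
  · simp [iteratedDeriv_fun_id_zero]
  · intro b _ hb
    simp [iteratedDeriv_fun_id_zero, hb]
  · intro hk
    simp at hk

variable {V : Type*} [NormedAddCommGroup V] [NormedSpace ℝ V] [CompleteSpace V]

theorem slice_analytic {g : V × ℝ → ℝ} {x : V} {y : ℝ} (hg : AnalyticAt ℝ g (x, y)) :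
    AnalyticAt ℝ (fun t => g (x, t)) y :=
  AnalyticAt.fun_comp (f := fun t : ℝ => (x, t)) hg (analyticAt_const.prod analyticAt_id)

theorem taylor (m : ℕ) : ∀ (f : V × ℝ → ℝ), AnalyticAt ℝ f 0 →
    ∃ (c : ℕ → V → ℝ) (u : V × ℝ → ℝ), (∀ j, AnalyticAt ℝ (c j) 0) ∧ AnalyticAt ℝ u 0 ∧
      (∀ᶠ z in 𝓝 (0 : V × ℝ), f z = ∑ j ∈ Finset.range m, c j z.1 * z.2 ^ j + z.2 ^ m * u z) ∧
      (∀ j < m, ∀ᶠ x in 𝓝 (0 : V), iteratedDeriv j (fun t => f (x, t)) 0 = j.factorial * c j x) ∧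
      iteratedDeriv m (fun t => f ((0 : V), t)) 0 = m.factorial * u 0 := by
  induction m with
  | zero =>
    intro f hf
    refine ⟨fun _ _ => 0, f, fun _ => analyticAt_const, hf, by simp, by simp, ?_⟩
    simp [Prod.zero_eq_mk]
  | succ m ih =>
    intro f hf
    obtain ⟨g, hg, hfg⟩ := hadamard hf (ContinuousLinearMap.snd ℝ V ℝ) ((0 : V), (1 : ℝ))
    obtain ⟨c, u, hc, hu, h1, h2, h3⟩ := ih g hg
    have hfg' : ∀ᶠ z in 𝓝 (0 : V × ℝ), f z = f (z.1, 0) + z.2 * g z := by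
      filter_upwards [hfg] with z hz
      rw [hz, proj_apply]
      congr 2
      ext <;> simp
    have hsl : ∀ᶠ x in 𝓝 (0 : V), ∀ᶠ t in 𝓝 (0 : ℝ), f (x, t) = f (x, 0) + t * g (x, t) :=
      Filter.Eventually.curry_nhds (x := (0 : V)) (y := (0 : ℝ)) hfg'
    have hga : ∀ᶠ x in 𝓝 (0 : V), AnalyticAt ℝ (fun t => g (x, t)) 0 := by
      have := (Filter.Eventually.curry_nhds (x := (0 : V)) (y := (0 : ℝ)) hg.eventually_analyticAt)
      filter_upwards [this] with x hx
      exact slice_analytic hx.self_of_nhds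
    have hd : ∀ᶠ x in 𝓝 (0 : V), ∀ k, iteratedDeriv (k + 1) (fun t => f (x, t)) 0
        = (k + 1) * iteratedDeriv k (fun t => g (x, t)) 0 := by
      filter_upwards [hsl, hga] with x hx hx' k
      exact iteratedDeriv_mul_id hx' hx k
    refine ⟨fun j => Nat.casesOn j (fun x => f (x, 0)) c, u, ?_, hu, ?_, ?_, ?_⟩
    · rintro (_ | j)
      · exact AnalyticAt.fun_comp (f := fun x : V => (x, (0 : ℝ))) (by exact hf)
          (analyticAt_id.prod analyticAt_const)
      · exact hc j
    · filter_upwards [hfg', h1] with z hz hz'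
      rw [hz, hz', Finset.sum_range_succ']
      have : ∑ j ∈ Finset.range m, c j z.1 * z.2 ^ (j + 1)
          = z.2 * ∑ j ∈ Finset.range m, c j z.1 * z.2 ^ j := by
        rw [Finset.mul_sum]
        exact Finset.sum_congr rfl fun j _ => by ring
      show _ = ∑ j ∈ Finset.range m, c j z.1 * z.2 ^ (j + 1) + f (z.1, 0) * z.2 ^ 0 + _
      rw [this]
      ring
    · rintro (_ | j) hj
      · simp
      · filter_upwards [h2 j (by omega), hd] with x hx hx'
        rw [hx' j, hx, Nat.factorial_succ]
        push_cast
        ring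
    · rw [hd.self_of_nhds m, h3, Nat.factorial_succ]
      push_cast
      ring

theorem max_contact {f : V × ℝ → ℝ} (hf : AnalyticAt ℝ f 0) {e : ℕ}
    (h0 : ∀ k ≤ e, iteratedDeriv k (fun t => f ((0 : V), t)) 0 = 0)
    (h1 : iteratedDeriv (e + 1) (fun t => f ((0 : V), t)) 0 ≠ 0) :
    ∃ (ψ : V → ℝ) (c : ℕ → V → ℝ) (u : V × ℝ → ℝ), AnalyticAt ℝ ψ 0 ∧ ψ 0 = 0 ∧
      (∀ j, AnalyticAt ℝ (c j) 0) ∧ AnalyticAt ℝ u 0 ∧ u 0 ≠ 0 ∧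
      (∀ᶠ z in 𝓝 (0 : V × ℝ), f (z.1, z.2 + ψ z.1)
        = ∑ j ∈ Finset.range e, c j z.1 * z.2 ^ j + z.2 ^ (e + 1) * u z) := by
  -- the function of which we take the zero set
  obtain ⟨c, u, hc, hu, -, hder, -⟩ := taylor (e + 1)
    (fun w : (V × ℝ) × ℝ => f (w.1.1, w.2 + w.1.2))
    (AnalyticAt.fun_comp (f := fun w : (V × ℝ) × ℝ => (w.1.1, w.2 + w.1.2)) (by simpa [← Prod.zero_eq_mk] using hf)
      ((analyticAt_fst.fun_comp analyticAt_fst).prod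
        (analyticAt_snd.fun_add (analyticAt_snd.fun_comp analyticAt_fst))))
  set G := c e with hG
  have hGa : AnalyticAt ℝ G 0 := hc e
  have hfac : (e.factorial : ℝ) ≠ 0 := by positivity
  have hGd : ∀ᶠ z in 𝓝 (0 : V × ℝ), iteratedDeriv e (fun t => f (z.1, t)) z.2
      = e.factorial * G z := by
    filter_upwards [hder e (by omega)] with z hz
    rw [← hz]
    have := congrFun (iteratedDeriv_comp_add_const e (fun t => f (z.1, t)) z.2) 0
    simp only [zero_add] at this
    exact this.symm
  have hG0 : G 0 = 0 := by
    have := hGd.self_of_nhds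
    have h' := h0 e le_rfl
    simp only [Prod.fst_zero, Prod.snd_zero] at this
    rw [h'] at this
    simpa [hfac] using this.symm
  have hGs : ∀ᶠ s in 𝓝 (0 : ℝ), iteratedDeriv e (fun t => f ((0 : V), t)) s
      = e.factorial * G (0, s) :=
    (Filter.Eventually.curry_nhds (x := (0 : V)) (y := (0 : ℝ)) hGd).self_of_nhds
  have hder1 : iteratedDeriv (e + 1) (fun t => f ((0 : V), t)) 0
      = e.factorial * deriv (fun s => G (0, s)) 0 := by
    rw [iteratedDeriv_succ, Filter.EventuallyEq.deriv_eq (f := fun s => _ * G (0, s)) hGs,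
      deriv_const_mul_field]
  have hslope : fderiv ℝ G 0 ((0 : V), (1 : ℝ)) = deriv (fun s => G (0, s)) 0 := by
    have h := hGa.differentiableAt.hasFDerivAt
    have h2 : HasDerivAt (fun s : ℝ => ((0 : V), s)) ((0 : V), (1 : ℝ)) 0 :=
      (hasDerivAt_const _ _).prodMk (hasDerivAt_id _)
    exact ((HasFDerivAt.comp_hasDerivAt (0 : ℝ) (f := fun s : ℝ => ((0 : V), s)) h h2).deriv).symm
  have hne : fderiv ℝ G 0 ((0 : V), (1 : ℝ)) ≠ 0 := by
    rw [hslope]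
    intro h
    rw [hder1, h, mul_zero] at h1
    exact h1 rfl
  have hinv : (fderiv ℝ G 0 ∘L ContinuousLinearMap.inr ℝ V ℝ).IsInvertible := by
    refine ⟨ContinuousLinearEquiv.unitsEquivAut ℝ (Units.mk0 _ hne), ?_⟩
    ext
    simp
  have hcd : ContDiffAt ℝ ⊤ G 0 := hGa.contDiffAt
  set ψ := hcd.implicitFunction (by simp) hinv with hψ
  have hψa : AnalyticAt ℝ ψ 0 := (hcd.contDiffAt_implicitFunction (by simp) hinv).analyticAt
  have hψ0 : ψ 0 = 0 := hcd.implicitFunction_apply_self (by simp) hinv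
  have hψz : ∀ᶠ x in 𝓝 (0 : V), G (x, ψ x) = 0 := by
    have := hcd.eventually_apply_implicitFunction (by simp) hinv
    rw [hG0] at this
    exact this
  have hsh : AnalyticAt ℝ (fun z : V × ℝ => (z.1, z.2 + ψ z.1)) 0 :=
    analyticAt_fst.prod (analyticAt_snd.fun_add
      (AnalyticAt.fun_comp (f := fun z : V × ℝ => z.1) (by exact hψa) analyticAt_fst))
  obtain ⟨c', u', hc', hu', hex, hder', htop⟩ := taylor (e + 1)
    (fun z : V × ℝ => f (z.1, z.2 + ψ z.1))
    (AnalyticAt.fun_comp (f := fun z : V × ℝ => (z.1, z.2 + ψ z.1)) (by simpa [hψ0, ← Prod.zero_eq_mk] using hf) hsh)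
  refine ⟨ψ, c', u', hψa, hψ0, hc', hu', ?_, ?_⟩
  · intro h
    rw [h, mul_zero] at htop
    simp only [hψ0, add_zero] at htop
    exact h1 htop
  · have hcz : ∀ᶠ x in 𝓝 (0 : V), c' e x = 0 := by
      have htd : Tendsto (fun x : V => (x, ψ x)) (𝓝 0) (𝓝 0) := by
        have := (continuousAt_id (x := (0 : V))).prodMk hψa.continuousAt
        simpa [ContinuousAt, hψ0, ← Prod.zero_eq_mk] using this
      filter_upwards [hder' e (by omega), hψz, htd.eventually hGd] with x h1 h2 h3
      have := congrFun (iteratedDeriv_comp_add_const e (fun t => f (x, t)) (ψ x)) 0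
      simp only [zero_add] at this
      rw [this, h3, h2, mul_zero] at h1
      simpa [hfac] using h1.symm
    have hcz' : ∀ᶠ z in 𝓝 (0 : V × ℝ), c' e z.1 = 0 :=
      (continuous_fst.tendsto (0 : V × ℝ)).eventually hcz
    filter_upwards [hex, hcz'] with z h1 h2
    rw [h1, Finset.sum_range_succ, h2]
    ring

end Taylor
end WR

namespace WR
open Set Filter Topology
set_option linter.unusedSectionVars false

section Mono
variable {n : ℕ}

/-- Normal crossings on `ℝⁿ × ℝ`. -/
def NC2 (F : (Fin n → ℝ) × ℝ → ℝ) : Prop :=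
  ∃ (α : Fin n → ℕ) (k : ℕ) (u : (Fin n → ℝ) × ℝ → ℝ), AnalyticAt ℝ u 0 ∧ u 0 ≠ 0 ∧
    ∀ᶠ z in 𝓝 0, F z = mon α z.1 * z.2 ^ k * u z

lemma NC2.congr (f g : (Fin n → ℝ) × ℝ → ℝ) (h : f =ᶠ[𝓝 0] g) (hf : NC2 f) : NC2 g := by
  obtain ⟨α, k, u, hu, hu0, he⟩ := hf
  refine ⟨α, k, u, hu, hu0, ?_⟩
  filter_upwards [he, h] with z h1 h2
  rw [← h2, h1]

lemma expand1 (m : ℕ) : ∀ (φ u : ℝ → ℝ) (a : ℕ → ℝ), AnalyticAt ℝ u 0 →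
    (∀ᶠ t in 𝓝 0, φ t = ∑ j ∈ Finset.range m, a j * t ^ j + t ^ m * u t) →
    ∀ j < m, iteratedDeriv j φ 0 = j.factorial * a j := by
  induction m with
  | zero => intro φ u a _ _ j hj; omega
  | succ m ih =>
    intro φ u a hu h j hj
    set g : ℝ → ℝ := fun t => ∑ j ∈ Finset.range m, a (j + 1) * t ^ j + t ^ m * u t with hg
    have hga : AnalyticAt ℝ g 0 := by
      refine AnalyticAt.fun_add (Finset.analyticAt_fun_sum _ fun j _ => ?_)
        ((analyticAt_id.fun_pow m).fun_mul hu)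
      exact analyticAt_const.fun_mul (analyticAt_id.fun_pow j)
    have h' : ∀ᶠ t in 𝓝 0, φ t = a 0 + t * g t := by
      filter_upwards [h] with t ht
      rw [ht, Finset.sum_range_succ', hg]
      have : ∑ j ∈ Finset.range m, a (j + 1) * t ^ (j + 1)
          = t * ∑ j ∈ Finset.range m, a (j + 1) * t ^ j := by
        rw [Finset.mul_sum]
        exact Finset.sum_congr rfl fun j _ => by ring
      rw [this]
      ring
    rcases j with _ | j
    · have := h'.self_of_nhds
      simpa using this
    · rw [iteratedDeriv_mul_id hga h' j, ih g u (fun j => a (j + 1)) hu (by simp [hg]) j (by omega),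
        Nat.factorial_succ]
      push_cast
      ring

/-- Statement of monomialization relative to the last variable. -/
def SS (n k : ℕ) : Prop := ∀ (g : (Fin n → ℝ) → ℝ) (f : (Fin n → ℝ) × ℝ → ℝ),
  AnalyticAt ℝ g 0 → (¬ ∀ᶠ x in 𝓝 0, g x = 0) → AnalyticAt ℝ f 0 →
  iteratedDeriv k (fun t => f ((0 : Fin n → ℝ), t)) 0 ≠ 0 → Res NC2 (fun z => g z.1 * f z)

lemma fst_comp {A : (Fin n → ℝ) → ℝ} (hA : AnalyticAt ℝ A 0) :
    AnalyticAt ℝ (fun z : (Fin n → ℝ) × ℝ => A z.1) 0 :=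
  AnalyticAt.fun_comp (f := fun z : (Fin n → ℝ) × ℝ => z.1) (by exact hA) analyticAt_fst

lemma comp0 {E F G : Type*} [NormedAddCommGroup E] [NormedSpace ℝ E]
    [NormedAddCommGroup F] [NormedSpace ℝ F] [NormedAddCommGroup G] [NormedSpace ℝ G]
    {A : F → G} {π : E → F} (hA : AnalyticAt ℝ A 0) (hπ : AnalyticAt ℝ π 0) (h0 : π 0 = 0) :
    AnalyticAt ℝ (fun z => A (π z)) 0 :=
  AnalyticAt.fun_comp (by rwa [h0]) hπ

lemma mon_at_zero {α : Fin n → ℕ} : mon α 0 = if α = 0 then 1 else 0 := by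
  split_ifs with h
  · simp [h, mon_zero]
  · obtain ⟨i, hi⟩ := Function.ne_iff.mp h
    exact mon_eq_zero (hi := hi) rfl

lemma mon_update (α : Fin n → ℕ) (i : Fin n) (x : Fin n → ℝ) (y : ℝ) :
    mon α (Function.update x i (x i * y)) = mon α x * y ^ α i := by
  unfold mon
  rw [← Finset.mul_prod_erase _ _ (Finset.mem_univ i),
    ← Finset.mul_prod_erase _ (fun j => x j ^ α j) (Finset.mem_univ i)]
  have : ∏ j ∈ Finset.univ.erase i, Function.update x i (x i * y) j ^ α j
      = ∏ j ∈ Finset.univ.erase i, x j ^ α j :=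
    Finset.prod_congr rfl fun j hj => by rw [Function.update_of_ne (Finset.ne_of_mem_erase hj)]
  rw [this, Function.update_self]
  ring

lemma poly_analytic {e : ℕ} {β : Fin n → ℕ} {b : ℕ → (Fin n → ℝ) → ℝ}
    (hb : ∀ j, AnalyticAt ℝ (b j) 0) {u : (Fin n → ℝ) × ℝ → ℝ} (hu : AnalyticAt ℝ u 0) (v : ℝ) :
    AnalyticAt ℝ (fun z : (Fin n → ℝ) × ℝ => ∑ j ∈ Finset.range e,
      mon β z.1 ^ (e + 1 - j) * b j z.1 * (z.2 + v) ^ j + (z.2 + v) ^ (e + 1) * u z) 0 := by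
  have hy : AnalyticAt ℝ (fun z : (Fin n → ℝ) × ℝ => z.2 + v) 0 :=
    analyticAt_snd.fun_add analyticAt_const
  refine AnalyticAt.fun_add (Finset.analyticAt_fun_sum _ fun j _ => ?_)
    ((hy.fun_pow _).fun_mul hu)
  exact (((fst_comp (mon_analytic β 0)).fun_pow _).fun_mul (fst_comp (hb j))).fun_mul (hy.fun_pow _)

lemma step4 (e : ℕ) (hS : ∀ k ≤ e, SS n k) (N : ℕ) : ∀ (β : Fin n → ℕ), ∑ i, β i = N →
    ∀ (g : (Fin n → ℝ) → ℝ) (b : ℕ → (Fin n → ℝ) → ℝ) (u : (Fin n → ℝ) × ℝ → ℝ),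
    AnalyticAt ℝ g 0 → NC g → (∀ j, AnalyticAt ℝ (b j) 0) → AnalyticAt ℝ u 0 → u 0 ≠ 0 →
    (∃ k < e, b k 0 ≠ 0) →
    Res NC2 (fun z : (Fin n → ℝ) × ℝ => g z.1 * (∑ j ∈ Finset.range e,
      mon β z.1 ^ (e + 1 - j) * b j z.1 * z.2 ^ j + z.2 ^ (e + 1) * u z)) := by
  induction N with
  | zero =>
    intro β hβ g b u hg hgn hb hu hu0 ⟨k, hk, hbk⟩
    have hβ0 : β = 0 := by
      ext i
      exact (Finset.sum_eq_zero_iff.mp hβ) i (Finset.mem_univ i)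
    refine hS k hk.le g _ hg hgn.ne (by simpa using poly_analytic hb hu 0) ?_
    have hsl : AnalyticAt ℝ (fun t : ℝ => t * u ((0 : Fin n → ℝ), t)) 0 :=
      analyticAt_id.fun_mul (slice_analytic (by exact hu))
    rw [expand1 e _ _ (fun j => b j 0) hsl _ k hk]
    · positivity
    · refine Eventually.of_forall fun t => ?_
      simp only [hβ0, mon_zero]
      simp only [one_pow, one_mul]
      ring
  | succ N ih =>
    intro β hβ g b u hg hgn hb hu hu0 hk
    obtain ⟨i, hi⟩ : ∃ i, β i ≠ 0 := by
      by_contra h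
      push Not at h
      simp [h] at hβ
    obtain ⟨β', rfl⟩ := mon_split hi
    have hβ' : ∑ i, β' i = N := by
      simp only [Pi.add_apply, Finset.sum_add_distrib] at hβ
      simpa using hβ
    have hmon : ∀ x, mon (β' + Pi.single i 1) x = mon β' x * x i := by
      intro x
      rw [mon_add, mon_single, pow_one]
    refine Res.step _ _ (cover_blow i) ?_ ?_
    · rintro π (rfl | ⟨v, rfl⟩)
      · exact ⟨blA_analytic i 0, blA_zero i⟩
      · exact ⟨blB_analytic i v 0, blB_zero i v⟩
    · rintro π (rfl | ⟨v, rfl⟩)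
      · apply Res.base
        obtain ⟨α, v, hv, hv0, hgv⟩ := hgn
        have hA := blA_analytic i (0 : (Fin n → ℝ) × ℝ)
        have hA1 : AnalyticAt ℝ (fun z => (blA i z).1) (0 : (Fin n → ℝ) × ℝ) :=
          analyticAt_fst.fun_comp hA
        have hA0 : (blA i (0 : (Fin n → ℝ) × ℝ)).1 = 0 := by rw [blA_zero]; rfl
        refine ⟨α, α i + (e + 1), fun z => v (blA i z).1 * (∑ j ∈ Finset.range e,
          (mon β' (blA i z).1 * z.1 i) ^ (e + 1 - j) * b j (blA i z).1 + u (blA i z)), ?_, ?_, ?_⟩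
        · refine (comp0 hv hA1 hA0).fun_mul (AnalyticAt.fun_add
            (Finset.analyticAt_fun_sum _ fun j _ => ?_) (comp0 hu hA (blA_zero i)))
          exact (((comp0 (mon_analytic β' 0) hA1 hA0).fun_mul (fst_coord_analytic i 0)).fun_pow
            _).fun_mul (comp0 (hb j) hA1 hA0)
        · show v (blA i 0).1 * _ ≠ 0
          rw [hA0, blA_zero, Finset.sum_eq_zero]
          · rw [zero_add]
            exact mul_ne_zero hv0 hu0
          · intro j hj
            have : e + 1 - j ≠ 0 := by
              have := Finset.mem_range.mp hj
              omega
            simp [this]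
        · filter_upwards [(tendsto_zero hA1 hA0).eventually hgv] with z hz
          have h2 : (blA i z).2 = z.2 := rfl
          have h1 : (blA i z).1 i = z.1 i * z.2 := by simp [blA]
          have h3 : mon α (blA i z).1 = mon α z.1 * z.2 ^ α i := mon_update α i z.1 z.2
          simp only [Function.comp_apply, hmon, h2, h1]
          rw [hz, h3]
          have : ∑ j ∈ Finset.range e, (mon β' (blA i z).1 * (z.1 i * z.2)) ^ (e + 1 - j)
                * b j (blA i z).1 * z.2 ^ j
              = z.2 ^ (e + 1) * ∑ j ∈ Finset.range e,
          (mon β' (blA i z).1 * z.1 i) ^ (e + 1 - j) * b j (blA i z).1 := by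
            rw [Finset.mul_sum]
            refine Finset.sum_congr rfl fun j hj => ?_
            have hj' : e + 1 = (e + 1 - j) + j := by
              have := Finset.mem_range.mp hj
              omega
            generalize e + 1 - j = m at hj'
            rw [hj']
            ring
          rw [this]
          ring
      · -- second chart
        have hB := blB_analytic i v (0 : (Fin n → ℝ) × ℝ)
        have hu' : AnalyticAt ℝ (fun z => u (blB i v z)) 0 := comp0 hu hB (blB_zero i v)
        have hg' : AnalyticAt ℝ (fun x => g x * x i ^ (e + 1)) 0 :=
          hg.fun_mul ((coord_analytic i 0).fun_pow _)
        have hgn' : NC (fun x => g x * x i ^ (e + 1)) := by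
          obtain ⟨α, w, hw, hw0, hgw⟩ := hgn
          refine ⟨α + Pi.single i (e + 1), w, hw, hw0, ?_⟩
          filter_upwards [hgw] with x hx
          rw [hx, mon_add, mon_single]
          ring
        have key : (fun z : (Fin n → ℝ) × ℝ => g z.1 * (∑ j ∈ Finset.range e,
            mon (β' + Pi.single i 1) z.1 ^ (e + 1 - j) * b j z.1 * z.2 ^ j + z.2 ^ (e + 1) * u z))
            ∘ blB i v = fun z : (Fin n → ℝ) × ℝ => (g z.1 * z.1 i ^ (e + 1)) *
              (∑ j ∈ Finset.range e, mon β' z.1 ^ (e + 1 - j) * b j z.1 * (z.2 + v) ^ j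
                + (z.2 + v) ^ (e + 1) * u (blB i v z)) := by
          funext z
          have h2 : (blB i v z).2 = z.1 i * (z.2 + v) := rfl
          have h1 : (blB i v z).1 = z.1 := rfl
          simp only [Function.comp_apply, hmon, h2, h1]
          have : ∑ j ∈ Finset.range e, (mon β' z.1 * z.1 i) ^ (e + 1 - j)
                * b j z.1 * (z.1 i * (z.2 + v)) ^ j
              = z.1 i ^ (e + 1) * ∑ j ∈ Finset.range e,
                mon β' z.1 ^ (e + 1 - j) * b j z.1 * (z.2 + v) ^ j := by
            rw [Finset.mul_sum]
            refine Finset.sum_congr rfl fun j hj => ?_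
            have hj' : e + 1 = (e + 1 - j) + j := by
              have := Finset.mem_range.mp hj
              omega
            generalize e + 1 - j = m at hj'
            rw [hj', mul_pow (z.1 i), mul_pow, pow_add]
            ring
          rw [this, mul_pow (z.1 i)]
          ring
        rw [key]
        by_cases hv : v = 0
        · subst hv
          simpa only [add_zero] using ih β' hβ' _ b _ hg' hgn' hb hu' (by rwa [blB_zero]) hk
        · refine hS e le_rfl (fun x => g x * x i ^ (e + 1)) _ hg' hgn'.ne
            (poly_analytic hb hu' v) ?_
          have hbl : ∀ t : ℝ, blB i v ((0 : Fin n → ℝ), t) = 0 := by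
            intro t
            simp [blB]
          simp only [hbl]
          rw [iteratedDeriv_comp_add_const e (fun s => ∑ j ∈ Finset.range e,
            mon β' 0 ^ (e + 1 - j) * b j 0 * s ^ j + s ^ (e + 1) * u 0) v]
          simp only [zero_add]
          rw [iteratedDeriv_fun_add (by fun_prop) (by fun_prop),
            iteratedDeriv_fun_sum (fun j _ => by fun_prop)]
          have hz : ∑ j ∈ Finset.range e, iteratedDeriv e
              (fun s => mon β' 0 ^ (e + 1 - j) * b j 0 * s ^ j) v = 0 := by
            refine Finset.sum_eq_zero fun j hj => ?_
            rw [iteratedDeriv_const_mul_field, iteratedDeriv_pow,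
              Nat.descFactorial_of_lt (Finset.mem_range.mp hj)]
            simp
          rw [hz, zero_add, iteratedDeriv_mul_const_field, iteratedDeriv_pow]
          have : (e + 1).descFactorial e ≠ 0 := by
            rw [Ne, Nat.descFactorial_eq_zero_iff_lt]
            omega
          have h1 : ((e + 1).descFactorial e : ℝ) ≠ 0 := by exact_mod_cast this
          exact mul_ne_zero (mul_ne_zero h1 (pow_ne_zero _ hv)) hu0

end Mono
end WR

namespace WR
open Set Filter Topology
set_option linter.unusedSectionVars false

section Mono2
variable {n : ℕ}

/-- Monomialization in `n` variables. -/
def PP (n : ℕ) : Prop := ∀ h : (Fin n → ℝ) → ℝ, AnalyticAt ℝ h 0 → (¬ ∀ᶠ x in 𝓝 0, h x = 0) →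
  Res NC h

lemma simul (hP : PP n) (S : Set ((Fin n → ℝ) → ℝ)) (hS : S.Finite)
    (hA : ∀ A ∈ S, AnalyticAt ℝ A 0) {B' : ((Fin n → ℝ) × ℝ → ℝ) → Prop}
    (G : (Fin n → ℝ) × ℝ → ℝ)
    (H : ∀ π : (Fin n → ℝ) → (Fin n → ℝ), AnalyticAt ℝ π 0 → π 0 = 0 →
      (∀ A ∈ S, (∀ᶠ x in 𝓝 0, A x = 0) ∨ NC (A ∘ π)) → Res B' (G ∘ Prod.map π id)) :
    Res B' G := by
  classical
  set s : Finset ((Fin n → ℝ) → ℝ) :=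
    hS.toFinset.filter (fun A => ¬ ∀ᶠ x in 𝓝 0, A x = 0) with hs
  have hsA : ∀ A ∈ s, AnalyticAt ℝ A 0 := fun A h => hA A (by
    rw [hs, Finset.mem_filter] at h
    simpa using h.1)
  have hne := germ_prod_ne s (fun A => A) hsA (fun A h => (Finset.mem_filter.mp h).2)
  have hR := hP (fun x => ∏ A ∈ s, A x) (Finset.analyticAt_fun_prod _ hsA) hne
  refine hR.lift G fun π hπ hπ0 hN => H π hπ hπ0 fun A hAS => ?_
  by_cases hz : ∀ᶠ x in 𝓝 0, A x = 0
  · exact Or.inl hz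
  · right
    have hAs : A ∈ s := by
      rw [hs, Finset.mem_filter]
      exact ⟨by simpa using hAS, hz⟩
    refine NC.factor hN (B := fun x => ∏ A' ∈ s.erase A, A' (π x)) (comp0 (A := A) (π := π) (hA A hAS) hπ hπ0)
      (Finset.analyticAt_fun_prod _ fun A' h' =>
        comp0 (hsA A' (Finset.mem_of_mem_erase h')) hπ hπ0) (Eventually.of_forall fun x => ?_)
    exact (Finset.mul_prod_erase s (fun A' => A' (π x)) hAs).symm

lemma mon_pw (α : Fin n → ℕ) (N : ℕ) (s x : Fin n → ℝ) :
    mon α (pw N s x) = mon α s * mon (N • α) x := by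
  rw [mon_smul]
  unfold mon pw
  rw [← Finset.prod_pow, ← Finset.prod_mul_distrib]
  refine Finset.prod_congr rfl fun i _ => ?_
  rw [mul_pow, ← pow_mul, ← pow_mul, mul_comm N]

lemma exists_least {J : Finset ℕ} (hJ : J.Nonempty) (γ : ℕ → Fin n → ℕ)
    (hc : ∀ j ∈ J, ∀ k ∈ J, γ j ≤ γ k ∨ γ k ≤ γ j) : ∃ k ∈ J, ∀ j ∈ J, γ k ≤ γ j := by
  obtain ⟨k, hk, hmin⟩ := J.exists_min_image (fun j => ∑ i, γ j i) hJ
  refine ⟨k, hk, fun j hj => ?_⟩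
  rcases hc k hk j hj with h | h
  · exact h
  · intro i
    by_contra hlt
    push Not at hlt
    have : ∑ i, γ j i < ∑ i, γ k i := Finset.sum_lt_sum (fun i _ => h i) ⟨i, Finset.mem_univ i, hlt⟩
    exact absurd (hmin j hj) (not_le.mpr this)

lemma step3 (e : ℕ) (hS : ∀ k ≤ e, SS n k)
    (g : (Fin n → ℝ) → ℝ) (c : ℕ → (Fin n → ℝ) → ℝ) (u : (Fin n → ℝ) × ℝ → ℝ)
    (hga : AnalyticAt ℝ g 0) (hg : NC g)
    (hu : AnalyticAt ℝ u 0) (hu0 : u 0 ≠ 0) (m : ℕ → ℕ)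
    (hm : ∀ j < e, m j * (e + 1 - j) = (e + 1).factorial)
    (h1 : ∀ j < e, (∀ᶠ x in 𝓝 0, c j x = 0) ∨ NC (c j))
    (h2 : ∀ j < e, ∀ k < e, (∀ᶠ x in 𝓝 0, c j x ^ m j - c k x ^ m k = 0) ∨
      NC (fun x => c j x ^ m j - c k x ^ m k)) :
    Res NC2 (fun z : (Fin n → ℝ) × ℝ => g z.1 * (∑ j ∈ Finset.range e,
      c j z.1 * z.2 ^ j + z.2 ^ (e + 1) * u z)) := by
  classical
  by_cases hall : ∀ j < e, ∀ᶠ x in 𝓝 0, c j x = 0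
  · -- all coefficients vanish
    apply Res.base
    obtain ⟨α, v, hv, hv0, hgv⟩ := hg
    refine ⟨α, e + 1, fun z => v z.1 * u z, (fst_comp hv).fun_mul hu, mul_ne_zero hv0 hu0, ?_⟩
    have hall' : ∀ᶠ x in 𝓝 (0 : Fin n → ℝ), ∀ j ∈ Finset.range e, c j x = 0 :=
      (Finset.eventually_all _).mpr fun j hj => hall j (Finset.mem_range.mp hj)
    have ht := continuous_fst.tendsto (0 : (Fin n → ℝ) × ℝ)
    filter_upwards [ht.eventually hgv, ht.eventually hall'] with z h3 h4
    rw [h3, Finset.sum_eq_zero fun j hj => by rw [h4 j hj, zero_mul]]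
    ring
  · push Not at hall
    obtain ⟨j0, hj0, hj0n⟩ := hall
    set J := (Finset.range e).filter (fun j => NC (c j)) with hJ
    have hJne : J.Nonempty := ⟨j0, by
      rw [hJ, Finset.mem_filter]
      exact ⟨Finset.mem_range.mpr hj0, (h1 j0 hj0).resolve_left (by simpa using hj0n)⟩⟩
    have hJlt : ∀ j ∈ J, j < e := fun j hj => Finset.mem_range.mp (Finset.mem_filter.mp hj).1
    have hJN : ∀ j ∈ J, NC (c j) := fun j hj => (Finset.mem_filter.mp hj).2
    have hex : ∀ j, ∃ (α : Fin n → ℕ) (w : (Fin n → ℝ) → ℝ), j ∈ J → (AnalyticAt ℝ w 0 ∧ w 0 ≠ 0 ∧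
        ∀ᶠ x in 𝓝 0, c j x = mon α x * w x) := by
      intro j
      by_cases hj : j ∈ J
      · obtain ⟨α, w, h⟩ := hJN j hj
        exact ⟨α, w, fun _ => h⟩
      · exact ⟨0, 0, fun h => absurd h hj⟩
    choose γ w hw using hex
    have hcomp : ∀ j ∈ J, ∀ k ∈ J, m j • γ j ≤ m k • γ k ∨ m k • γ k ≤ m j • γ j := by
      intro j hj k hk
      obtain ⟨a1, a2, a3⟩ := hw j hj
      obtain ⟨b1, b2, b3⟩ := hw k hk
      have he : (fun x => c j x ^ m j - c k x ^ m k) =ᶠ[𝓝 0]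
          fun x => mon (m j • γ j) x * w j x ^ m j - mon (m k • γ k) x * w k x ^ m k := by
        filter_upwards [a3, b3] with x hx hx'
        rw [hx, hx', mon_smul, mon_smul]
        ring
      refine comparable (u := fun x => w j x ^ m j) (v := fun x => w k x ^ m k) (a1.fun_pow _)
        (pow_ne_zero _ a2) (b1.fun_pow _) (pow_ne_zero _ b2) ?_
      rcases h2 j (hJlt j hj) k (hJlt k hk) with h | h
      · left
        filter_upwards [h, he] with x hx hx'
        rw [← hx', hx]
      · exact Or.inr (h.congr he)
    obtain ⟨k, hk, hmin⟩ := exists_least hJne (fun j => m j • γ j) hcomp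
    set β := m k • γ k with hβ
    set N := (e + 1).factorial with hN
    have hN0 : N ≠ 0 := Nat.factorial_ne_zero _
    -- power substitution
    refine Res.lift_step (cover_pw hN0) ?_ ?_
    · rintro _ ⟨s, -, rfl⟩
      exact ⟨pw_analytic N s 0, pw_zero hN0 s⟩
    rintro _ ⟨s, hs, rfl⟩
    have hpa := pw_analytic N s 0
    have hp0 := pw_zero hN0 s
    have hms : ∀ α, mon α s ≠ 0 := fun α => Finset.prod_ne_zero_iff.mpr fun i _ => by
      apply pow_ne_zero
      rcases hs i with h | h <;> simp [h]
    have hNC : NC (fun x => g (pw N s x)) := by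
      obtain ⟨α, v, hv, hv0, hgv⟩ := hg
      refine ⟨N • α, fun x => mon α s * v (pw N s x), analyticAt_const.fun_mul (comp0 hv hpa hp0),
        ?_, ?_⟩
      · show mon α s * v (pw N s 0) ≠ 0
        rw [hp0]
        exact mul_ne_zero (hms α) hv0
      · filter_upwards [(tendsto_zero hpa hp0).eventually hgv] with x hx
        rw [hx, mon_pw]
        ring
    set b : ℕ → (Fin n → ℝ) → ℝ := fun j x => if j ∈ J then
      mon (γ j) s * mon ((e + 1 - j) • (m j • γ j - β)) x * w j (pw N s x) else 0 with hb
    have hba : ∀ j, AnalyticAt ℝ (b j) 0 := by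
      intro j
      by_cases hj : j ∈ J
      · simp only [hb, hj, if_true]
        exact (analyticAt_const.fun_mul (mon_analytic _ 0)).fun_mul (comp0 (hw j hj).1 hpa hp0)
      · simp only [hb, hj, if_false]
        exact analyticAt_const
    have hbk : b k 0 ≠ 0 := by
      simp only [hb, hk, if_true, ← hβ, hp0]
      refine mul_ne_zero (mul_ne_zero (hms _) ?_) (hw k hk).2.1
      rw [tsub_self, smul_zero, mon_zero]
      exact one_ne_zero
    have hcb : ∀ j < e, ∀ᶠ x in 𝓝 0, c j (pw N s x) = mon β x ^ (e + 1 - j) * b j x := by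
      intro j hj
      by_cases hjJ : j ∈ J
      · filter_upwards [(tendsto_zero hpa hp0).eventually (hw j hjJ).2.2] with x hx
        rw [hx, mon_pw]
        simp only [hb, hjJ, if_true]
        have : N • γ j = (e + 1 - j) • β + (e + 1 - j) • (m j • γ j - β) := by
          rw [← smul_add, add_tsub_cancel_of_le (hmin j hjJ), smul_smul, mul_comm, hm j hj]
        rw [this, mon_add, mon_smul]
        ring
      · have hz : ∀ᶠ x in 𝓝 0, c j x = 0 := (h1 j hj).resolve_right fun h => hjJ (by
          rw [hJ, Finset.mem_filter]
          exact ⟨Finset.mem_range.mpr hj, h⟩)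
        filter_upwards [(tendsto_zero hpa hp0).eventually hz] with x hx
        simp [hx, hb, hjJ]
    have hmap0 : Prod.map (pw N s) id (0 : (Fin n → ℝ) × ℝ) = 0 := by
      simp [Prod.map, hp0]
    have hR := step4 e hS _ β rfl (fun x => g (pw N s x)) b (fun z => u (Prod.map (pw N s) id z))
      (comp0 hga hpa hp0) hNC hba (comp0 hu (map_analytic hpa) hmap0) (by rwa [hmap0])
      ⟨k, hJlt k hk, hbk⟩
    refine Res.congr NC2.congr hR ?_
    have hcb' : ∀ᶠ x in 𝓝 (0 : Fin n → ℝ), ∀ j ∈ Finset.range e,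
        c j (pw N s x) = mon β x ^ (e + 1 - j) * b j x :=
      (Finset.eventually_all _).mpr fun j hj => hcb j (Finset.mem_range.mp hj)
    have ht := continuous_fst.tendsto (0 : (Fin n → ℝ) × ℝ)
    filter_upwards [ht.eventually hcb'] with z hz
    simp only [Function.comp_apply, Prod.map_fst, Prod.map_snd, id]
    congr 2
    exact Finset.sum_congr rfl fun j hj => by rw [hz j hj]

theorem mainS (hP : PP n) (d : ℕ) : SS n d := by
  induction d using Nat.strong_induction_on with
  | _ d ih =>
  intro g f hg hgn hf hd
  by_cases hlow : ∃ k < d, iteratedDeriv k (fun t => f ((0 : Fin n → ℝ), t)) 0 ≠ 0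
  · obtain ⟨k, hk, hk'⟩ := hlow
    exact ih k hk g f hg hgn hf hk'
  push Not at hlow
  rcases d with _ | e
  · have hf0 : f 0 ≠ 0 := by simpa [← Prod.zero_eq_mk] using hd
    refine simul hP {g} (finite_singleton g) (by simpa using hg) _ fun π hπ hπ0 h => Res.base _ ?_
    obtain ⟨α, v, hv, hv0, hgv⟩ := (h g rfl).resolve_left hgn
    have hmap0 : Prod.map π id (0 : (Fin n → ℝ) × ℝ) = 0 := by
      simp [Prod.map, hπ0]
    refine ⟨α, 0, fun z => v z.1 * f (Prod.map π id z),
      (fst_comp hv).fun_mul (comp0 hf (map_analytic hπ) hmap0), ?_, ?_⟩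
    · show v 0 * f (Prod.map π id 0) ≠ 0
      rw [hmap0]
      exact mul_ne_zero hv0 hf0
    · filter_upwards [(continuous_fst.tendsto (0 : (Fin n → ℝ) × ℝ)).eventually hgv] with z hz
      simp only [Function.comp_apply] at hz
      simp only [Function.comp_apply, Prod.map_fst, hz]
      ring
  · obtain ⟨ψ, c, u, hψ, hψ0, hc, hu, hu0, hex⟩ := max_contact hf
      (fun k hk => hlow k (by omega)) hd
    have hψ' := fst_comp hψ
    refine Res.of_single (σ := fun z : (Fin n → ℝ) × ℝ => (z.1, z.2 + ψ z.1))
      (τ := fun z : (Fin n → ℝ) × ℝ => (z.1, z.2 - ψ z.1))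
      (analyticAt_fst.prod (analyticAt_snd.fun_add hψ')) (by simp [hψ0])
      (analyticAt_fst.prod (analyticAt_snd.fun_sub hψ')).continuousAt (by simp [hψ0])
      (Eventually.of_forall fun z => by simp) ?_
    refine Res.congr NC2.congr (f := fun z : (Fin n → ℝ) × ℝ => g z.1 * (∑ j ∈ Finset.range e,
      c j z.1 * z.2 ^ j + z.2 ^ (e + 1) * u z)) ?_ ?_
    swap
    · filter_upwards [hex] with z hz
      simp only [Function.comp_apply]
      rw [hz]
    set m : ℕ → ℕ := fun j => (e + 1).factorial / (e + 1 - j) with hm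
    have hm' : ∀ j < e, m j * (e + 1 - j) = (e + 1).factorial := fun j hj =>
      Nat.div_mul_cancel (Nat.dvd_factorial (by omega) (by omega))
    set D : ℕ × ℕ → (Fin n → ℝ) → ℝ := fun p x => c p.1 x ^ m p.1 - c p.2 x ^ m p.2 with hD
    refine simul hP (insert g (c '' Iio e ∪ D '' (Iio e ×ˢ Iio e)))
      ((((finite_Iio e).image c).union (((finite_Iio e).prod (finite_Iio e)).image D)).insert g)
      ?_ _ ?_
    · rintro A (rfl | ⟨j, -, rfl⟩ | ⟨p, -, rfl⟩)
      · exact hg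
      · exact hc j
      · exact ((hc p.1).fun_pow _).fun_sub ((hc p.2).fun_pow _)
    · intro π hπ hπ0 hA
      have ht := tendsto_zero hπ hπ0
      have hmap0 : Prod.map π id (0 : (Fin n → ℝ) × ℝ) = 0 := by
        simp [Prod.map, hπ0]
      refine step3 e (fun k hk => ih k (by omega)) (fun x => g (π x)) (fun j x => c j (π x))
        (fun z => u (Prod.map π id z)) (comp0 hg hπ hπ0)
        ((hA g (mem_insert _ _)).resolve_left hgn)
        (comp0 hu (map_analytic hπ) hmap0) (by rwa [hmap0]) m hm' ?_ ?_
      · intro j hj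
        rcases hA (c j) (Or.inr (Or.inl ⟨j, hj, rfl⟩)) with h | h
        · exact Or.inl (ht.eventually h)
        · exact Or.inr h
      · intro j hj k hk
        rcases hA (D (j, k)) (Or.inr (Or.inr ⟨(j, k), ⟨hj, hk⟩, rfl⟩)) with h | h
        · exact Or.inl (ht.eventually h)
        · exact Or.inr h

end Mono2
end WR

namespace WR
open Set Filter Topology
set_option linter.unusedSectionVars false

section All

lemma exists_dir {n : ℕ} {f : (Fin (n + 1) → ℝ) → ℝ} (hf : AnalyticAt ℝ f 0)
    (hne : ¬ ∀ᶠ x in 𝓝 0, f x = 0) :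
    ∃ v : Fin (n + 1) → ℝ, v ≠ 0 ∧ ¬ ∀ᶠ t in 𝓝 (0 : ℝ), f (t • v) = 0 := by
  by_contra hcon
  push Not at hcon
  apply hne
  have h0 : f 0 = 0 := by
    have := (hcon (fun _ => 1) (by
      intro h
      simpa using congrFun h 0)).self_of_nhds
    simpa using this
  have hall : ∀ v : Fin (n + 1) → ℝ, ∀ᶠ t in 𝓝 (0 : ℝ), f (t • v) = 0 := by
    intro v
    by_cases hv : v = 0
    · simp [hv, h0]
    · exact hcon v hv
  obtain ⟨r, hr, hball⟩ := Metric.eventually_nhds_iff_ball.mp hf.eventually_analyticAt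
  filter_upwards [Metric.ball_mem_nhds 0 hr] with v hv
  have hpre : IsPreconnected ((fun t : ℝ => t • v) ⁻¹' Metric.ball 0 r) := by
    apply Convex.isPreconnected
    exact (convex_ball (0 : Fin (n + 1) → ℝ) r).linear_preimage (LinearMap.toSpanSingleton ℝ _ v)
  have han : AnalyticOnNhd ℝ (fun t : ℝ => f (t • v)) ((fun t : ℝ => t • v) ⁻¹' Metric.ball 0 r) := by
    intro t ht
    exact AnalyticAt.fun_comp (f := fun t : ℝ => t • v) (hball _ ht)
      (analyticAt_id.smul analyticAt_const)
  have := han.eqOn_zero_of_preconnected_of_eventuallyEq_zero hpre (z₀ := 0)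
    (by simpa using hr) (hall v) (show (1 : ℝ) ∈ _ by simpa using hv)
  simpa using this

lemma NC_of_NC2 {n : ℕ} (F : (Fin n → ℝ) × ℝ → ℝ) (e : (Fin (n + 1) → ℝ) ≃L[ℝ] (Fin n → ℝ) × ℝ)
    (he : ∀ x, e x = (fun i => x i.succ, x 0)) (hF : NC2 F) : NC (F ∘ e) := by
  obtain ⟨α, k, u, hu, hu0, h⟩ := hF
  refine ⟨Fin.cons k α, fun x => u (e x), comp0 hu (e.analyticAt 0) e.map_zero,
    by simpa using hu0, ?_⟩
  have ht : Tendsto e (𝓝 0) (𝓝 0) := by simpa using e.continuous.tendsto 0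
  filter_upwards [ht.eventually h] with x hx
  simp only [Function.comp_apply]
  rw [hx, he]
  unfold mon
  rw [Fin.prod_univ_succ]
  simp only [Fin.cons_zero, Fin.cons_succ]
  ring

theorem PP_all (n : ℕ) : PP n := by
  induction n with
  | zero =>
    intro h ha hne
    refine Res.base _ ⟨0, h, ha, ?_, Eventually.of_forall fun x => by rw [mon_zero, one_mul]⟩
    intro h0
    apply hne
    refine Eventually.of_forall fun x => ?_
    rw [Subsingleton.elim x 0, h0]
  | succ n ih =>
    intro f hf hne
    obtain ⟨v, hv, hφ⟩ := exists_dir hf hne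
    set E0 : ((Fin n → ℝ) × ℝ) ≃L[ℝ] (Fin (n + 1) → ℝ) :=
      (ContinuousLinearEquiv.prodComm ℝ (Fin n → ℝ) ℝ).trans (Fin.consEquivL ℝ fun _ => ℝ) with hE0
    have hE0s : ∀ x, E0.symm x = (fun i => x i.succ, x 0) := by
      intro x
      rfl
    have hl : E0 (0, 1) ≠ 0 := by
      intro h
      have := E0.injective (h.trans E0.map_zero.symm)
      simpa using congrArg Prod.snd this
    obtain ⟨T, hT⟩ := SeparatingDual.exists_continuousLinearEquiv_apply_eq (R := ℝ) hl hv
    have hfT : AnalyticAt ℝ (fun x => f (T x)) 0 := comp0 hf (T.analyticAt 0) T.map_zero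
    have hF : AnalyticAt ℝ (fun z => f (T (E0 z))) 0 :=
      comp0 (A := fun x => f (T x)) (π := E0) hfT (E0.analyticAt 0) E0.map_zero
    have hsl : ∀ t : ℝ, T (E0 (0, t)) = t • v := by
      intro t
      have : ((0 : Fin n → ℝ), t) = t • ((0 : Fin n → ℝ), (1 : ℝ)) := by simp
      rw [this, map_smul, map_smul, hT]
    have hex : ∃ k, iteratedDeriv k (fun t => f (T (E0 ((0 : Fin n → ℝ), t)))) 0 ≠ 0 := by
      simp only [hsl]
      have han : AnalyticAt ℝ (fun t : ℝ => f (t • v)) 0 :=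
        comp0 hf (analyticAt_id.smul analyticAt_const) (by simp)
      have hnt : analyticOrderAt (fun t : ℝ => f (t • v)) 0 ≠ ⊤ := by
        rw [Ne, analyticOrderAt_eq_top]
        exact hφ
      obtain ⟨k, hk⟩ := ENat.ne_top_iff_exists.mp hnt
      exact ⟨k, ((analyticOrderAt_eq_nat_iff_iteratedDeriv_eq_zero han).mp hk.symm).2⟩
    obtain ⟨k, hk⟩ := hex
    have hR := mainS ih k (fun _ => 1) (fun z => f (T (E0 z))) analyticAt_const
      (fun h => one_ne_zero h.self_of_nhds) hF hk
    have hR2 := hR.transport (B' := NC) E0.symm (fun F => NC_of_NC2 F E0.symm hE0s)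
    have heq : (fun z : (Fin n → ℝ) × ℝ => 1 * f (T (E0 z))) ∘ E0.symm = f ∘ T := by
      funext x
      simp
    rw [heq] at hR2
    exact Res.of_single (T.analyticAt 0) T.map_zero T.symm.continuous.continuousAt T.symm.map_zero
      (Eventually.of_forall fun z => T.apply_symm_apply z) hR2

end All
end WR

namespace WR
open Set Filter Topology
set_option linter.unusedSectionVars false

section Cons

/-- The zero set of `f` is covered by finitely many analytic images. -/
def ZC {E : Type*} [NormedAddCommGroup E] [NormedSpace ℝ E] (f : E → ℝ) : Prop :=
  ∃ 𝒮 : Set (E → E), (∀ ψ ∈ 𝒮, AnalyticAt ℝ ψ 0 ∧ ψ 0 = 0 ∧ ∀ᶠ x in 𝓝 0, f (ψ x) = 0) ∧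
    ∀ N : (E → E) → Set E, (∀ ψ ∈ 𝒮, N ψ ∈ 𝓝 0) → ∃ T ⊆ 𝒮, T.Finite ∧
      ∀ᶠ z in 𝓝 0, f z = 0 → ∃ ψ ∈ T, z ∈ ψ '' N ψ

lemma ZC_base {n : ℕ} {f : (Fin n → ℝ) → ℝ} (hf : NC f) : ZC f := by
  obtain ⟨α, u, hu, hu0, h⟩ := hf
  refine ⟨(fun i => (P0 i : (Fin n → ℝ) → (Fin n → ℝ))) '' {i | α i ≠ 0}, ?_, ?_⟩
  · rintro _ ⟨i, hi, rfl⟩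
    refine ⟨(P0 i).analyticAt 0, map_zero _, ?_⟩
    filter_upwards [(P0_tendsto i).eventually h] with x hx
    rw [hx, mon_eq_zero (hi := hi) (P0_same i x), zero_mul]
  · intro N hN
    refine ⟨_, Subset.rfl, (Set.toFinite _).image _, ?_⟩
    have hN' : ∀ᶠ z in 𝓝 (0 : Fin n → ℝ), ∀ i, α i ≠ 0 → z ∈ N (P0 i) := by
      rw [eventually_all]
      intro i
      by_cases hi : α i ≠ 0
      · filter_upwards [hN _ ⟨i, hi, rfl⟩] with z hz _
        exact hz
      · exact Eventually.of_forall fun z h => absurd h hi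
    filter_upwards [h, hu.continuousAt.eventually_ne hu0, hN'] with z h1 h2 h3 h4
    rw [h4] at h1
    have hm : mon α z = 0 := (mul_eq_zero.mp h1.symm).resolve_right h2
    obtain ⟨i, hi, hzi⟩ : ∃ i, α i ≠ 0 ∧ z i = 0 := by
      obtain ⟨i, _, hi⟩ := Finset.prod_eq_zero_iff.1 hm
      refine ⟨i, fun h0 => ?_, by simpa using (pow_eq_zero_iff (M₀ := ℝ) (n := α i) (fun h0 => by simp [h0] at hi)).mp hi⟩
      simp [h0] at hi
    refine ⟨_, ⟨i, hi, rfl⟩, z, h3 i hi, ?_⟩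
    ext j
    by_cases hj : j = i
    · subst hj
      exact (P0_same j z).trans hzi.symm
    · exact P0_ne hj z

lemma ZC_of_Res {n : ℕ} {f : (Fin n → ℝ) → ℝ} (hf : Res NC f) : ZC f := by
  induction hf with
  | base f h => exact ZC_base h
  | step f S hS ha h ih =>
    choose! 𝒮 h1 h2 using ih
    refine ⟨⋃ π ∈ S, (fun ψ => π ∘ ψ) '' 𝒮 π, ?_, ?_⟩
    · intro ψ' hψ'
      simp only [mem_iUnion, exists_prop] at hψ'
      obtain ⟨π, hπ, ψ, hψ, rfl⟩ := hψ'
      obtain ⟨a1, a2, a3⟩ := h1 π hπ ψ hψ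
      obtain ⟨b1, b2⟩ := ha π hπ
      refine ⟨comp0 (A := π) (π := ψ) b1 a1 a2, by simp [a2, b2], a3⟩
    · intro N hN
      have h3 : ∀ π ∈ S, ∃ T ⊆ 𝒮 π, T.Finite ∧
          ∀ᶠ z in 𝓝 0, (f ∘ π) z = 0 → ∃ ψ ∈ T, z ∈ ψ '' N (π ∘ ψ) := by
        intro π hπ
        refine h2 π hπ (fun ψ => N (π ∘ ψ)) fun ψ hψ => hN _ ?_
        simp only [mem_iUnion, exists_prop]
        exact ⟨π, hπ, ψ, hψ, rfl⟩
      choose! T hT hTf hTe using h3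
      obtain ⟨T0, hT0, hT0f, hcov⟩ := hS (fun π => {z | (f ∘ π) z = 0 → ∃ ψ ∈ T π,
        z ∈ ψ '' N (π ∘ ψ)}) hTe
      refine ⟨⋃ π ∈ T0, (fun ψ => π ∘ ψ) '' T π, ?_, ?_, ?_⟩
      · exact iUnion₂_subset fun π hπ => (image_mono (hT π (hT0 hπ))).trans
          (subset_biUnion_of_mem (u := fun π => (fun ψ => π ∘ ψ) '' 𝒮 π) (hT0 hπ))
      · exact hT0f.biUnion fun π hπ => (hTf π (hT0 hπ)).image _
      · filter_upwards [hcov] with z hz hz0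
        simp only [mem_iUnion, exists_prop] at hz
        obtain ⟨π, hπ, x, hx, rfl⟩ := hz
        obtain ⟨ψ, hψ, y, hy, rfl⟩ := hx hz0
        refine ⟨π ∘ ψ, ?_, y, hy, rfl⟩
        simp only [mem_iUnion, exists_prop]
        exact ⟨π, hπ, ψ, hψ, rfl⟩

theorem ZC_all {n : ℕ} {f : (Fin n → ℝ) → ℝ} (hf : AnalyticAt ℝ f 0) : ZC f := by
  by_cases hz : ∀ᶠ x in 𝓝 0, f x = 0
  · refine ⟨{id}, ?_, ?_⟩
    · rintro _ rfl
      exact ⟨analyticAt_id, rfl, hz⟩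
    · intro N hN
      refine ⟨{id}, Subset.rfl, finite_singleton _, ?_⟩
      filter_upwards [hN id rfl] with z hz _
      exact ⟨id, rfl, z, hz, rfl⟩
  · exact ZC_of_Res (PP_all n f hf hz)

/-- Łojasiewicz inequality at `0`. -/
def LJw {E : Type*} [NormedAddCommGroup E] (C : ℝ) (ν : ℕ) (f : E → ℝ) : Prop :=
  ∀ᶠ x in 𝓝 0, ∃ x', f x' = 0 ∧ ‖x - x'‖ ^ ν ≤ C * |f x|

def LJ {E : Type*} [NormedAddCommGroup E] (f : E → ℝ) : Prop :=
  ∃ (C : ℝ) (ν : ℕ), 0 ≤ C ∧ 0 < ν ∧ LJw C ν f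

lemma LJw.strong {E : Type*} [NormedAddCommGroup E] {C : ℝ} {ν : ℕ} {f : E → ℝ}
    (h : LJw C ν f) (hf : ContinuousAt f 0) (h0 : f 0 = 0) {ε : ℝ} (hε : 0 < ε) :
    ∀ᶠ x in 𝓝 0, ∃ x', ‖x'‖ < ε ∧ ‖x - x'‖ < ε ∧ f x' = 0 ∧ ‖x - x'‖ ^ ν ≤ C * |f x| := by
  have ht : Tendsto (fun x => C * |f x|) (𝓝 0) (𝓝 0) := by
    have : ContinuousAt (fun x => C * |f x|) 0 := continuousAt_const.mul hf.abs
    simpa [ContinuousAt, h0] using this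
  have he : (0 : ℝ) < (ε / 2) ^ ν := by positivity
  have hn : ∀ᶠ x in 𝓝 (0 : E), ‖x‖ < ε / 2 := by
    have : Tendsto (fun x : E => ‖x‖) (𝓝 0) (𝓝 0) := tendsto_norm_zero
    exact this.eventually_lt_const (by positivity)
  filter_upwards [h, ht.eventually_lt_const he, hn] with x ⟨x', h1, h2⟩ h3 h4
  have h5 : ‖x - x'‖ < ε / 2 := lt_of_pow_lt_pow_left₀ ν (by positivity) (h2.trans_lt h3)
  refine ⟨x', ?_, by linarith, h1, h2⟩
  have : ‖x'‖ ≤ ‖x‖ + ‖x - x'‖ := by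
    have := norm_sub_le x (x - x')
    simpa using this
  linarith

lemma LJ_base {n : ℕ} {f : (Fin n → ℝ) → ℝ} (hf : NC f) (h0 : f 0 = 0) : LJ f := by
  obtain ⟨α, u, hu, hu0, h⟩ := hf
  have hα : α ≠ 0 := by
    rintro rfl
    have := h.self_of_nhds
    rw [h0, mon_zero, one_mul] at this
    exact hu0 this.symm
  obtain ⟨i0, hi0⟩ := Function.ne_iff.mp hα
  have hu0' : 0 < |u 0| := abs_pos.mpr hu0
  refine ⟨2 / |u 0|, ∑ i, α i, by positivity, ?_, ?_⟩
  · exact Finset.sum_pos' (fun _ _ => Nat.zero_le _) ⟨i0, Finset.mem_univ _, Nat.pos_of_ne_zero hi0⟩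
  have h1 : ∀ᶠ x in 𝓝 (0 : Fin n → ℝ), |u 0| / 2 < |u x| :=
    hu.continuousAt.abs.eventually_const_lt (by linarith)
  have h2 : ∀ᶠ x in 𝓝 (0 : Fin n → ℝ), ∀ i, f (P0 i x) = mon α (P0 i x) * u (P0 i x) := by
    rw [eventually_all]
    exact fun i => (P0_tendsto i).eventually h
  filter_upwards [h, h1, h2] with x hx hux hP
  obtain ⟨i, hi, hmin⟩ := (Finset.univ.filter fun i => α i ≠ 0).exists_min_image (fun i => |x i|)
    ⟨i0, by simpa using hi0⟩
  have hi' : α i ≠ 0 := by simpa using hi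
  refine ⟨P0 i x, ?_, ?_⟩
  · rw [hP i, mon_eq_zero (hi := hi') (P0_same i x), zero_mul]
  · have hn : ‖x - P0 i x‖ ≤ |x i| := by
      rw [pi_norm_le_iff_of_nonneg (abs_nonneg _)]
      intro j
      by_cases hj : j = i
      · subst hj
        simp [P0_same]
      · simp [P0_ne hj]
    have hmon : |x i| ^ (∑ j, α j) ≤ |mon α x| := by
      unfold mon
      rw [Finset.abs_prod, ← Finset.prod_pow_eq_pow_sum]
      refine Finset.prod_le_prod (fun _ _ => by positivity) fun j _ => ?_
      rw [abs_pow]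
      by_cases hj : α j = 0
      · simp [hj]
      · exact pow_le_pow_left₀ (abs_nonneg _) (hmin j (by simpa using hj)) _
    calc ‖x - P0 i x‖ ^ (∑ i, α i) ≤ |x i| ^ (∑ j, α j) := pow_le_pow_left₀ (norm_nonneg _) hn _
      _ ≤ |mon α x| := hmon
      _ = 2 / |u 0| * (|mon α x| * (|u 0| / 2)) := by field_simp
      _ ≤ 2 / |u 0| * (|mon α x| * |u x|) := by gcongr
      _ = 2 / |u 0| * |f x| := by rw [hx, abs_mul]

lemma LJ_of_Res {n : ℕ} {f : (Fin n → ℝ) → ℝ} (hf : Res NC f) :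
    ContinuousAt f 0 → f 0 = 0 → LJ f := by
  induction hf with
  | base f h => exact fun _ h0 => LJ_base h h0
  | step f S hS ha h ih =>
    intro hfc hf0
    -- the local statement for each chart
    have key : ∀ π ∈ S, ∃ (C : ℝ) (ν : ℕ) (M : Set (Fin n → ℝ)), 0 ≤ C ∧ 0 < ν ∧ M ∈ 𝓝 0 ∧
        ∀ x ∈ M, ∃ z', f z' = 0 ∧ ‖π x - z'‖ ≤ 1 ∧ ‖π x - z'‖ ^ ν ≤ C * |f (π x)| := by
      intro π hπ
      obtain ⟨hπa, hπ0⟩ := ha π hπ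
      have hc : ContinuousAt (f ∘ π) 0 :=
        ContinuousAt.comp (by rwa [hπ0]) hπa.continuousAt
      have hz : (f ∘ π) 0 = 0 := by simp [hπ0, hf0]
      obtain ⟨C, ν, hC, hν, hLJ⟩ := ih π hπ hc hz
      obtain ⟨K, U, hU, hK⟩ := (hπa.contDiffAt (n := 1)).exists_lipschitzOnWith
      obtain ⟨r, hr, hrU⟩ := Metric.mem_nhds_iff.mp hU
      have hK1 : (0 : ℝ) < K + 1 := by positivity
      set ε := min r (1 / (K + 1)) with hε
      have hε0 : 0 < ε := lt_min hr (by positivity)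
      refine ⟨(K + 1 : ℝ) ^ ν * C, ν, _, by positivity, hν,
        inter_mem (hLJ.strong hc hz hε0) hU, ?_⟩
      rintro x ⟨⟨x', h1, h2, h3, h4⟩, hxU⟩
      have hx'U : x' ∈ U := hrU (by simpa using h1.trans_le (min_le_left _ _))
      have hl : ‖π x - π x'‖ ≤ (K + 1) * ‖x - x'‖ := by
        have := hK.dist_le_mul x hxU x' hx'U
        rw [dist_eq_norm, dist_eq_norm] at this
        nlinarith [norm_nonneg (x - x')]
      refine ⟨π x', h3, ?_, ?_⟩
      · refine hl.trans ?_
        have : ‖x - x'‖ ≤ 1 / (K + 1) := (h2.trans_le (min_le_right _ _)).le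
        calc (K + 1 : ℝ) * ‖x - x'‖ ≤ (K + 1) * (1 / (K + 1)) := by gcongr
          _ = 1 := by field_simp
      · calc ‖π x - π x'‖ ^ ν ≤ ((K + 1) * ‖x - x'‖) ^ ν := pow_le_pow_left₀ (norm_nonneg _) hl _
          _ = (K + 1) ^ ν * ‖x - x'‖ ^ ν := mul_pow _ _ _
          _ ≤ (K + 1) ^ ν * (C * |f (π x)|) := by
              gcongr
              exact h4
          _ = _ := by ring
    choose! C ν M hC hν hM hkey using key
    obtain ⟨T, hTS, hTf, hcov⟩ := hS M hM
    set t := hTf.toFinset with ht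
    have htS : ∀ π ∈ t, π ∈ S := fun π hπ => hTS (by simpa [ht] using hπ)
    refine ⟨∑ π ∈ t, C π, ∑ π ∈ t, ν π + 1, Finset.sum_nonneg fun π hπ => hC π (htS π hπ),
      by omega, ?_⟩
    filter_upwards [hcov] with z hz
    simp only [mem_iUnion, exists_prop] at hz
    obtain ⟨π, hπ, x, hx, rfl⟩ := hz
    have hπt : π ∈ t := by simpa [ht] using hπ
    obtain ⟨z', h1, h2, h3⟩ := hkey π (hTS hπ) x hx
    refine ⟨z', h1, ?_⟩
    have e1 : ν π ≤ ∑ π ∈ t, ν π + 1 :=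
      (Finset.single_le_sum (f := ν) (fun _ _ => Nat.zero_le _) hπt).trans (Nat.le_succ _)
    have e2 : C π ≤ ∑ π ∈ t, C π := Finset.single_le_sum (fun π hπ => hC π (htS π hπ)) hπt
    calc ‖π x - z'‖ ^ (∑ π ∈ t, ν π + 1) ≤ ‖π x - z'‖ ^ ν π :=
          pow_le_pow_of_le_one (norm_nonneg _) h2 e1
      _ ≤ C π * |f (π x)| := h3
      _ ≤ _ := by gcongr

theorem LJ_pi {n : ℕ} {f : (Fin n → ℝ) → ℝ} (hf : AnalyticAt ℝ f 0) (h0 : f 0 = 0) : LJ f := by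
  by_cases hz : ∀ᶠ x in 𝓝 0, f x = 0
  · refine ⟨0, 1, le_rfl, one_pos, ?_⟩
    filter_upwards [hz] with x hx
    exact ⟨x, hx, by simp⟩
  · exact LJ_of_Res (PP_all n f hf hz) hf.continuousAt h0

theorem LJ_all {E : Type*} [NormedAddCommGroup E] [NormedSpace ℝ E] [FiniteDimensional ℝ E]
    {f : E → ℝ} (hf : AnalyticAt ℝ f 0) (h0 : f 0 = 0) : LJ f := by
  set e : E ≃L[ℝ] (Fin (Module.finrank ℝ E) → ℝ) :=
    ContinuousLinearEquiv.ofFinrankEq (by simp) with he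
  obtain ⟨C, ν, hC, hν, h⟩ := LJ_pi (f := fun x => f (e.symm x))
    (comp0 hf (e.symm.analyticAt 0) e.symm.map_zero) (by simpa using h0)
  set K := ‖(e.symm : (Fin (Module.finrank ℝ E) → ℝ) →L[ℝ] E)‖ with hK
  refine ⟨K ^ ν * C, ν, by positivity, hν, ?_⟩
  have ht : Tendsto e (𝓝 0) (𝓝 0) := by simpa using e.continuous.tendsto 0
  filter_upwards [ht.eventually h] with x ⟨y, hy, hy'⟩
  refine ⟨e.symm y, hy, ?_⟩
  have h1 : ‖x - e.symm y‖ ≤ K * ‖e x - y‖ := by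
    have : x - e.symm y = e.symm (e x - y) := by simp
    rw [this]
    exact (e.symm : (Fin (Module.finrank ℝ E) → ℝ) →L[ℝ] E).le_opNorm _
  simp only [ContinuousLinearEquiv.symm_apply_apply] at hy'
  calc ‖x - e.symm y‖ ^ ν ≤ (K * ‖e x - y‖) ^ ν := pow_le_pow_left₀ (norm_nonneg _) h1 _
    _ = K ^ ν * ‖e x - y‖ ^ ν := mul_pow _ _ _
    _ ≤ K ^ ν * (C * |f x|) := by gcongr
    _ = _ := by ring

end Cons
end WR

namespace WR
open Set Filter Topology
set_option linter.unusedSectionVars false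

section Paths
variable {E : Type*} [NormedAddCommGroup E] [NormedSpace ℝ E] {X : Set E}

/-- `p` and `q` can be joined in `X` by a continuous path of length at most `L`. -/
def J (X : Set E) (p q : E) (L : ℝ) : Prop :=
  ∃ γ : ℝ → E, ContinuousOn γ (Icc 0 1) ∧ γ 0 = p ∧ γ 1 = q ∧ γ '' Icc 0 1 ⊆ X ∧
    eVariationOn γ (Icc 0 1) ≤ ENNReal.ofReal L

lemma J.mono {p q : E} {L L' : ℝ} (h : J X p q L) (hL : L ≤ L') : J X p q L' := by
  obtain ⟨γ, h1, h2, h3, h4, h5⟩ := h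
  exact ⟨γ, h1, h2, h3, h4, h5.trans (ENNReal.ofReal_le_ofReal hL)⟩

lemma J.left {p q : E} {L : ℝ} (h : J X p q L) : p ∈ X := by
  obtain ⟨γ, h1, h2, h3, h4, h5⟩ := h
  exact h4 ⟨0, by simp, h2⟩

lemma J.right {p q : E} {L : ℝ} (h : J X p q L) : q ∈ X := by
  obtain ⟨γ, h1, h2, h3, h4, h5⟩ := h
  exact h4 ⟨1, by simp, h3⟩

lemma J.symm {p q : E} {L : ℝ} (h : J X p q L) : J X q p L := by
  obtain ⟨γ, h1, h2, h3, h4, h5⟩ := h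
  have hm : MapsTo (fun t : ℝ => 1 - t) (Icc 0 1) (Icc 0 1) := by
    intro t ht
    simp only [mem_Icc] at ht ⊢
    constructor <;> linarith [ht.1, ht.2]
  refine ⟨γ ∘ fun t => 1 - t, h1.comp (by fun_prop) hm, by simpa using h3, by simpa using h2,
    ?_, ?_⟩
  · rintro _ ⟨t, ht, rfl⟩
    exact h4 ⟨_, hm ht, rfl⟩
  · refine le_trans (eVariationOn.comp_le_of_antitoneOn γ _ ?_ hm) h5
    intro a _ b _ hab
    simp only
    linarith

lemma J.trans {p q r : E} {L L' : ℝ} (hL : 0 ≤ L) (hL' : 0 ≤ L') (h : J X p q L)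
    (h' : J X q r L') : J X p r (L + L') := by
  obtain ⟨γ, h1, h2, h3, h4, h5⟩ := h
  obtain ⟨δ, g1, g2, g3, g4, g5⟩ := h'
  set η : ℝ → E := fun t => if t ≤ 1 / 2 then γ (2 * t) else δ (2 * t - 1) with hη
  have e1 : EqOn η (γ ∘ fun t => 2 * t) (Icc 0 (1 / 2)) := by
    intro t ht
    simp [hη, -one_div, ht.2]
  have e2 : EqOn η (δ ∘ fun t => 2 * t - 1) (Icc (1 / 2) 1) := by
    intro t ht
    rcases eq_or_lt_of_le ht.1 with h | h
    · subst h
      simp [hη, h3, g2]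
    · simp [hη, -one_div, not_le.2 h]
  have m1 : MapsTo (fun t : ℝ => 2 * t) (Icc 0 (1 / 2)) (Icc 0 1) := by
    intro t ht
    simp only [mem_Icc] at ht ⊢
    constructor <;> linarith [ht.1, ht.2]
  have m2 : MapsTo (fun t : ℝ => 2 * t - 1) (Icc (1 / 2) 1) (Icc 0 1) := by
    intro t ht
    simp only [mem_Icc] at ht ⊢
    constructor <;> linarith [ht.1, ht.2]
  have hu : (Icc 0 (1 / 2) ∪ Icc (1 / 2) 1 : Set ℝ) = Icc 0 1 :=
    Icc_union_Icc_eq_Icc (by norm_num) (by norm_num)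
  refine ⟨η, ?_, ?_, ?_, ?_, ?_⟩
  · rw [← hu]
    refine ContinuousOn.union_of_isClosed ?_ ?_ isClosed_Icc isClosed_Icc
    · exact (h1.comp (by fun_prop) m1).congr e1
    · exact (g1.comp (by fun_prop) m2).congr e2
  · simp [hη, h2]
  · norm_num [hη, g3]
  · rw [← hu]
    rintro _ ⟨t, ht | ht, rfl⟩
    · rw [e1 ht]; exact h4 ⟨_, m1 ht, rfl⟩
    · rw [e2 ht]; exact g4 ⟨_, m2 ht, rfl⟩
  · have := eVariationOn.Icc_add_Icc η (s := univ) (a := (0 : ℝ)) (b := 1 / 2) (c := 1)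
      (by norm_num) (by norm_num) (mem_univ _)
    simp only [univ_inter] at this
    rw [← this, ENNReal.ofReal_add hL hL', eVariationOn.eq_of_eqOn e1, eVariationOn.eq_of_eqOn e2]
    refine add_le_add (le_trans (eVariationOn.comp_le_of_monotoneOn γ _ ?_ m1) h5)
      (le_trans (eVariationOn.comp_le_of_monotoneOn δ _ ?_ m2) g5)
    · intro a _ b _ hab
      simp only
      linarith
    · intro a _ b _ hab
      simp only
      linarith

lemma J.refl {p : E} (hp : p ∈ X) : J X p p 0 := by
  refine ⟨fun _ => p, continuousOn_const, rfl, rfl, ?_, ?_⟩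
  · rintro _ ⟨t, _, rfl⟩
    exact hp
  · rw [eVariationOn.constant_on]
    · simp
    · rintro _ ⟨t, _, rfl⟩ _ ⟨s, _, rfl⟩
      rfl

lemma J_segment {F : Type*} [NormedAddCommGroup F] [NormedSpace ℝ F] {φ : F → E} {B : Set F}
    {K : NNReal} (hB : Convex ℝ B) (hφ : LipschitzOnWith K φ B) (hm : MapsTo φ B X) {x y : F}
    (hx : x ∈ B) (hy : y ∈ B) : J X (φ x) (φ y) (K * ‖x - y‖) := by
  have hl : MapsTo (fun t : ℝ => x + t • (y - x)) (Icc 0 1) B := by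
    intro t ht
    exact hB.add_smul_sub_mem hx hy ht
  have hlip : LipschitzOnWith (K * ‖x - y‖₊) (φ ∘ fun t : ℝ => x + t • (y - x)) (Icc 0 1) := by
    refine hφ.comp (LipschitzWith.lipschitzOnWith ?_) hl
    refine LipschitzWith.of_dist_le_mul fun s t => ?_
    rw [dist_add_left, dist_eq_norm, ← sub_smul, norm_smul, coe_nnnorm, dist_eq_norm,
      norm_sub_rev x y, mul_comm]
  refine ⟨_, hlip.continuousOn, by simp, by simp, ?_, ?_⟩
  · rintro _ ⟨t, ht, rfl⟩
    exact hm (hl ht)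
  · have h1 := hlip.comp_eVariationOn_le (g := id) (s := Icc (0 : ℝ) 1) (mapsTo_id _)
    have h2 := (monotone_id (α := ℝ)).monotoneOn univ |>.eVariationOn_eq (mem_univ 0) (mem_univ 1)
    simp only [univ_inter, id, sub_zero, ENNReal.ofReal_one] at h2
    have h3 : eVariationOn id (Icc (0 : ℝ) 1) = 1 := h2
    rw [h3, mul_one, Function.comp_id] at h1
    refine h1.trans (le_of_eq ?_)
    rw [← ENNReal.ofReal_coe_nnreal]
    simp

end Paths
end WR

namespace WR
open Set Filter Topology
set_option linter.unusedSectionVars false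

section Quant
variable {E : Type*} [NormedAddCommGroup E] [NormedSpace ℝ E] {X : Set E}

/-- Local quantitative joinability on a set of pairs. -/
def Q (X : Set E) (A : Set (E × E)) : Prop :=
  ∃ (δ C : ℝ) (ν : ℕ), 0 < δ ∧ δ ≤ 1 ∧ 0 ≤ C ∧ 0 < ν ∧ ∀ p q, (p, q) ∈ A → ‖p - q‖ < δ →
    J X p q (C * ‖p - q‖ ^ (1 / (ν : ℝ)))

lemma Q.mono {A B : Set (E × E)} (h : Q X B) (hAB : A ⊆ B) : Q X A := by
  obtain ⟨δ, C, ν, h1, h2, h3, h4, h5⟩ := h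
  exact ⟨δ, C, ν, h1, h2, h3, h4, fun p q hpq => h5 p q (hAB hpq)⟩

lemma Q_empty : Q X ∅ := ⟨1, 0, 1, one_pos, le_rfl, le_rfl, one_pos, fun _ _ h => h.elim⟩

lemma rpow_aux {D C C' : ℝ} {ν ν' : ℕ} (hD : 0 ≤ D) (hD1 : D ≤ 1) (hC : 0 ≤ C) (hCC : C ≤ C')
    (hν : 0 < ν) (hνν : ν ≤ ν') : C * D ^ (1 / (ν : ℝ)) ≤ C' * D ^ (1 / (ν' : ℝ)) := by
  have : D ^ (1 / (ν : ℝ)) ≤ D ^ (1 / (ν' : ℝ)) := by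
    refine Real.rpow_le_rpow_of_exponent_ge_of_imp hD hD1 ?_ ?_
    · exact one_div_le_one_div_of_le (by exact_mod_cast hν) (by exact_mod_cast hνν)
    · intro _ h
      have : (0 : ℝ) < ν := by exact_mod_cast hν
      have := one_div_pos.2 this
      linarith
  gcongr
  linarith

lemma Q.union {A B : Set (E × E)} (h : Q X A) (h' : Q X B) : Q X (A ∪ B) := by
  obtain ⟨δ, C, ν, h1, h2, h3, h4, h5⟩ := h
  obtain ⟨δ', C', ν', g1, g2, g3, g4, g5⟩ := h'
  refine ⟨min δ δ', C + C', ν + ν', lt_min h1 g1, (min_le_left _ _).trans h2, by positivity,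
    by omega, ?_⟩
  rintro p q (hpq | hpq) hd
  · refine (h5 p q hpq (hd.trans_le (min_le_left _ _))).mono ?_
    exact rpow_aux (norm_nonneg _) ((hd.le.trans (min_le_left _ _)).trans h2) h3 (by linarith) h4
      (by omega)
  · refine (g5 p q hpq (hd.trans_le (min_le_right _ _))).mono ?_
    exact rpow_aux (norm_nonneg _) ((hd.le.trans (min_le_left _ _)).trans h2) g3 (by linarith) g4
      (by omega)

lemma Q_biUnion {ι : Type*} {T : Set ι} (hT : T.Finite) {A : ι → Set (E × E)}
    (h : ∀ i ∈ T, Q X (A i)) : Q X (⋃ i ∈ T, A i) := by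
  induction T, hT using Set.Finite.induction_on with
  | empty => simpa using Q_empty
  | insert _ _ ih =>
    rw [biUnion_insert]
    exact (h _ (mem_insert _ _)).union (ih fun i hi => h i (mem_insert_of_mem _ hi))

end Quant

section Pair
variable {E : Type*} [NormedAddCommGroup E] [InnerProductSpace ℝ E] [FiniteDimensional ℝ E]
  {X : Set E}
variable {V : Type*} [NormedAddCommGroup V] [NormedSpace ℝ V] [FiniteDimensional ℝ V]

/-- A good chart. -/
def Good (X : Set E) (φ : V → E) (r : ℝ) : Prop :=
  0 < r ∧ ∃ K : NNReal, AnalyticOnNhd ℝ φ (Metric.ball 0 r) ∧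
    LipschitzOnWith K φ (Metric.ball 0 r) ∧ MapsTo φ (Metric.ball 0 r) X

lemma final_ineq {K K' C D a b : ℝ} {ν : ℕ} (hν : 0 < ν) (hK : 0 ≤ K) (hK' : 0 ≤ K') (hC : 0 ≤ C)
    (hD : 0 ≤ D) (hD1 : D ≤ 1) {t : ℝ} (ht : 0 ≤ t) (hat : a ≤ t) (hbt : b ≤ t)
    (h : t ^ ν ≤ C * D ^ 2) :
    K * a + K' * b ≤ (K + K') * C ^ (1 / (ν : ℝ)) * D ^ (1 / (ν : ℝ)) := by
  have h1 : t ^ ν ≤ C * D := by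
    refine h.trans ?_
    gcongr
    nlinarith
  have h2 : t ≤ (C * D) ^ (1 / (ν : ℝ)) := by
    have := Real.rpow_le_rpow (by positivity) h1 (by positivity : (0 : ℝ) ≤ (ν : ℝ)⁻¹)
    rwa [Real.pow_rpow_inv_natCast ht hν.ne', ← one_div] at this
  rw [Real.mul_rpow hC hD] at h2
  calc K * a + K' * b ≤ K * t + K' * t := by gcongr
    _ = (K + K') * t := by ring
    _ ≤ (K + K') * (C ^ (1 / (ν : ℝ)) * D ^ (1 / (ν : ℝ))) := by gcongr
    _ = _ := by ring

lemma pair_local {φ φ' : V → E} {r r' : ℝ} (h : Good X φ r) (h' : Good X φ' r') {x₀ y₀ : V}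
    (hx₀ : x₀ ∈ Metric.ball (0 : V) r) (hy₀ : y₀ ∈ Metric.ball (0 : V) r') :
    ∃ s ∈ 𝓝 (x₀, y₀), Q X ((fun z : V × V => (φ z.1, φ' z.2)) '' s) := by
  obtain ⟨hr, K, ha, hl, hm⟩ := h
  obtain ⟨hr', K', ha', hl', hm'⟩ := h'
  have hφ := ha x₀ hx₀
  have hφ' := ha' y₀ hy₀
  by_cases hne : φ x₀ = φ' y₀
  · set F : V × V → ℝ := fun z => ‖φ (x₀ + z.1) - φ' (y₀ + z.2)‖ ^ 2 with hF
    have hFa : AnalyticAt ℝ F 0 := by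
      have hn : ∀ w : E, AnalyticAt ℝ (fun w : E => ‖w‖ ^ 2) w := fun w =>
        (contDiff_norm_sq ℝ (n := ⊤)).contDiffAt.analyticAt
      have a1 : AnalyticAt ℝ (fun z : V × V => φ (x₀ + z.1)) 0 :=
        AnalyticAt.fun_comp (g := φ) (f := fun z : V × V => x₀ + z.1) (by simpa using hφ)
          (analyticAt_const.add analyticAt_fst)
      have a2 : AnalyticAt ℝ (fun z : V × V => φ' (y₀ + z.2)) 0 :=
        AnalyticAt.fun_comp (g := φ') (f := fun z : V × V => y₀ + z.2) (by simpa using hφ')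
          (analyticAt_const.add analyticAt_snd)
      exact AnalyticAt.fun_comp (g := fun w : E => ‖w‖ ^ 2)
        (f := fun z : V × V => φ (x₀ + z.1) - φ' (y₀ + z.2)) (hn _) (a1.sub a2)
    have hF0 : F 0 = 0 := by simp [hF, hne]
    obtain ⟨C, ν, hC, hν, hLJ⟩ := LJ_all hFa hF0
    obtain ⟨ε, hε, hεr⟩ := Metric.isOpen_iff.1 Metric.isOpen_ball x₀ hx₀
    obtain ⟨ε', hε', hεr'⟩ := Metric.isOpen_iff.1 Metric.isOpen_ball y₀ hy₀
    have hst := hLJ.strong hFa.continuousAt hF0 (lt_min hε hε')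
    have hsmall : ∀ᶠ z : V × V in 𝓝 0, ‖z‖ < min ε ε' := by
      have := Metric.ball_mem_nhds (0 : V × V) (lt_min hε hε')
      filter_upwards [this] with z hz
      simpa using hz
    have htr : Tendsto (fun z : V × V => z - (x₀, y₀)) (𝓝 (x₀, y₀)) (𝓝 0) := by
      have : ContinuousAt (fun z : V × V => z - (x₀, y₀)) (x₀, y₀) := by fun_prop
      simpa [ContinuousAt] using this
    refine ⟨_, htr.eventually (hst.and hsmall), 1, (K + K') * C ^ (1 / (ν : ℝ)), ν, one_pos,
      le_rfl, by positivity, hν, ?_⟩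
    rintro _ _ ⟨⟨x, y⟩, ⟨⟨⟨u, v⟩, hw1, -, hw3, hw4⟩, hz⟩, heq⟩ hd
    simp only [Prod.mk.injEq] at heq
    obtain ⟨rfl, rfl⟩ := heq
    simp only [Prod.mk_sub_mk, Prod.norm_mk, sup_lt_iff, lt_min_iff] at hw1 hz
    have inb : ∀ (u : V), ‖u‖ < ε → x₀ + u ∈ Metric.ball (0 : V) r := fun u hu =>
      hεr (by simpa using hu)
    have inb' : ∀ (u : V), ‖u‖ < ε' → y₀ + u ∈ Metric.ball (0 : V) r' := fun u hu =>
      hεr' (by simpa using hu)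
    have hx := inb _ hz.1.1
    have hy := inb' _ hz.2.2
    have hu := inb _ hw1.1.1
    have hv := inb' _ hw1.2.2
    have hF2 : F ((x, y) - (x₀, y₀)) = ‖φ x - φ' y‖ ^ 2 := by simp [hF]
    rw [hF2, abs_of_nonneg (by positivity)] at hw4
    rw [add_sub_cancel] at hx hy
    have huv : φ (x₀ + u) = φ' (y₀ + v) := by
      have : ‖φ (x₀ + u) - φ' (y₀ + v)‖ ^ 2 = 0 := hw3
      rwa [sq_eq_zero_iff, norm_eq_zero, sub_eq_zero] at this
    have j1 := J_segment (convex_ball _ _) hl hm hx hu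
    have j2 := J_segment (convex_ball _ _) hl' hm' hv hy
    rw [huv] at j1
    refine (J.trans (by positivity) (by positivity) j1 j2).mono ?_
    refine final_ineq hν (by positivity) (by positivity) hC (norm_nonneg _) hd.le (norm_nonneg _)
      ?_ ?_ hw4
    · refine le_trans (le_of_eq ?_) (norm_fst_le _)
      simp only [Prod.mk_sub_mk, sub_sub]
    · rw [norm_sub_rev]
      refine le_trans (le_of_eq ?_) (norm_snd_le _)
      simp only [Prod.mk_sub_mk, sub_sub]
  · have hd : 0 < ‖φ x₀ - φ' y₀‖ := norm_pos_iff.2 (sub_ne_zero.2 hne)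
    have hcont : ContinuousAt (fun z : V × V => ‖φ z.1 - φ' z.2‖) (x₀, y₀) := by
      have c1 : ContinuousAt (fun z : V × V => φ z.1) (x₀, y₀) :=
        ContinuousAt.comp (g := φ) hφ.continuousAt continuousAt_fst
      have c2 : ContinuousAt (fun z : V × V => φ' z.2) (x₀, y₀) :=
        ContinuousAt.comp (g := φ') hφ'.continuousAt continuousAt_snd
      exact (c1.sub c2).norm
    have hev : ∀ᶠ z : V × V in 𝓝 (x₀, y₀), ‖φ x₀ - φ' y₀‖ / 2 < ‖φ z.1 - φ' z.2‖ :=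
      hcont.eventually_const_lt (by simpa using half_lt_self hd)
    refine ⟨_, hev, min 1 (‖φ x₀ - φ' y₀‖ / 2), 0, 1, by positivity, min_le_left _ _, le_rfl,
      one_pos, ?_⟩
    rintro _ _ ⟨⟨x, y⟩, hz, heq⟩ hd'
    simp only [Prod.mk.injEq] at heq
    obtain ⟨rfl, rfl⟩ := heq
    have := hd'.trans_le (min_le_right _ _)
    exact absurd this (not_lt.2 (le_of_lt hz))

lemma pair_global {φ φ' : V → E} {r r' : ℝ} (h : Good X φ r) (h' : Good X φ' r') :
    Q X ((φ '' Metric.closedBall 0 (r / 2)) ×ˢ (φ' '' Metric.closedBall 0 (r' / 2))) := by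
  have : Q X ((fun z : V × V => (φ z.1, φ' z.2)) ''
      (Metric.closedBall 0 (r / 2) ×ˢ Metric.closedBall 0 (r' / 2))) := by
    refine ((isCompact_closedBall _ _).prod (isCompact_closedBall _ _)).induction_on
      (p := fun s => Q X ((fun z : V × V => (φ z.1, φ' z.2)) '' s)) ?_ ?_ ?_ ?_
    · simpa using Q_empty
    · intro s t hst ht
      exact ht.mono (image_mono hst)
    · intro s t hs ht
      rw [image_union]
      exact hs.union ht
    · rintro ⟨x, y⟩ ⟨hx, hy⟩
      obtain ⟨s, hs, hQ⟩ := pair_local h h' (x₀ := x) (y₀ := y)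
        (Metric.closedBall_subset_ball (half_lt_self h.1) hx)
        (Metric.closedBall_subset_ball (half_lt_self h'.1) hy)
      exact ⟨s, mem_nhdsWithin_of_mem_nhds hs, hQ⟩
  refine this.mono ?_
  rintro ⟨_, _⟩ ⟨⟨x, hx, rfl⟩, ⟨y, hy, rfl⟩⟩
  exact ⟨(x, y), ⟨hx, hy⟩, rfl⟩

/-- `X` is covered by finitely many good charts. -/
def Cov (V : Type*) [NormedAddCommGroup V] [NormedSpace ℝ V] (X S : Set E) : Prop :=
  ∃ T : Set ((V → E) × ℝ), T.Finite ∧ (∀ c ∈ T, Good X c.1 c.2) ∧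
    S ⊆ ⋃ c ∈ T, c.1 '' Metric.closedBall 0 (c.2 / 2)

lemma Cov.Q {S : Set E} (h : Cov V X S) : Q X (S ×ˢ S) := by
  obtain ⟨T, hT, hg, hS⟩ := h
  have := Q_biUnion (X := X) (hT.prod hT) (A := fun c =>
    (c.1.1 '' Metric.closedBall 0 (c.1.2 / 2)) ×ˢ (c.2.1 '' Metric.closedBall 0 (c.2.2 / 2)))
    (fun c hc => pair_global (hg _ hc.1) (hg _ hc.2))
  refine this.mono ?_
  rintro ⟨p, q⟩ ⟨hp, hq⟩
  obtain ⟨c, hc, hpc⟩ := mem_iUnion₂.1 (hS hp)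
  obtain ⟨d, hd, hqd⟩ := mem_iUnion₂.1 (hS hq)
  exact mem_iUnion₂.2 ⟨(c, d), ⟨hc, hd⟩, hpc, hqd⟩

end Pair
end WR

namespace WR
open Set Filter Topology
set_option linter.unusedSectionVars false

section Charts
variable {n : ℕ} {X : Set (EuclideanSpace ℝ (Fin n))}

lemma good_exists {φ : (Fin n → ℝ) → EuclideanSpace ℝ (Fin n)} (ha : AnalyticAt ℝ φ 0)
    (hX : ∀ᶠ x in 𝓝 0, φ x ∈ X) : ∃ r, Good X φ r := by
  obtain ⟨r₁, h1, h1'⟩ := ha.exists_ball_analyticOnNhd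
  obtain ⟨K, t, ht, hK⟩ := (ha.contDiffAt (n := 1)).exists_lipschitzOnWith
  obtain ⟨r₂, h2, h2'⟩ := Metric.mem_nhds_iff.1 (inter_mem ht hX)
  refine ⟨min r₁ r₂, lt_min h1 h2, K, ?_, ?_, ?_⟩
  · exact h1'.mono (Metric.ball_subset_ball (min_le_left _ _))
  · exact hK.mono fun x hx => (h2' (Metric.ball_subset_ball (min_le_right _ _) hx)).1
  · exact fun x hx => (h2' (Metric.ball_subset_ball (min_le_right _ _) hx)).2

lemma cov_local {a : EuclideanSpace ℝ (Fin n)} {U : Set (EuclideanSpace ℝ (Fin n))}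
    (hU : IsOpen U) (haU : a ∈ U) {k : ℕ} {f : Fin k → EuclideanSpace ℝ (Fin n) → ℝ}
    (hf : ∀ i, AnalyticOn ℝ (f i) U) (hXU : X ∩ U = {q ∈ U | ∀ i, f i q = 0}) :
    ∃ t ∈ 𝓝 a, Cov (Fin n → ℝ) X (X ∩ t) := by
  set e := EuclideanSpace.equiv (Fin n) ℝ with he
  set F : (Fin n → ℝ) → ℝ := fun z => ∑ i, (f i (a + e.symm z)) ^ 2 with hF
  have hsm : ∀ z, AnalyticAt ℝ (fun z => a + e.symm z) z := fun z =>
    analyticAt_const.add (e.symm.analyticAt z)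
  have hFa : AnalyticAt ℝ F 0 := by
    refine Finset.analyticAt_fun_sum _ fun i _ => AnalyticAt.fun_pow ?_ 2
    refine AnalyticAt.fun_comp (g := f i) (f := fun z => a + e.symm z) ?_ (hsm 0)
    have := (hU.analyticOn_iff_analyticOnNhd.1 (hf i)) a haU
    simpa using this
  have hiff : ∀ z, a + e.symm z ∈ U → (F z = 0 ↔ a + e.symm z ∈ X) := by
    intro z hz
    have h1 : a + e.symm z ∈ X ↔ a + e.symm z ∈ X ∩ U := by simp [hz]
    rw [h1, hXU, hF]
    simp only [mem_ofPred_eq, hz, true_and]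
    rw [Finset.sum_eq_zero_iff_of_nonneg (fun i _ => sq_nonneg _)]
    simp
  obtain ⟨𝒮, hS, hcov⟩ := ZC_all hFa
  have hgood : ∀ ψ ∈ 𝒮, ∃ r, Good X (fun x => a + e.symm (ψ x)) r := by
    intro ψ hψ
    obtain ⟨h1, h2, h3⟩ := hS ψ hψ
    refine good_exists (AnalyticAt.fun_comp (g := fun z => a + e.symm z) (hsm _) h1) ?_
    have hc : ContinuousAt (fun x => a + e.symm (ψ x)) 0 :=
      continuousAt_const.add (e.symm.continuous.continuousAt.comp h1.continuousAt)
    have hev : ∀ᶠ x in 𝓝 0, a + e.symm (ψ x) ∈ U :=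
      hc.eventually_mem (hU.mem_nhds (by simpa [h2] using haU))
    filter_upwards [h3, hev] with x hx hx'
    exact (hiff _ hx').1 hx
  choose! r hr using hgood
  obtain ⟨T, hTS, hT, hev⟩ := hcov (fun ψ => Metric.closedBall 0 (r ψ / 2))
    (fun ψ hψ => Metric.closedBall_mem_nhds _ (half_pos (hr ψ hψ).1))
  have htr : Tendsto (fun q => e (q - a)) (𝓝 a) (𝓝 0) := by
    have : ContinuousAt (fun q => e (q - a)) a := by fun_prop
    simpa [ContinuousAt] using this
  refine ⟨_, (htr.eventually hev).and (hU.mem_nhds haU),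
    (fun ψ => ((fun x => a + e.symm (ψ x)), r ψ)) '' T, hT.image _, ?_, ?_⟩
  · rintro _ ⟨ψ, hψ, rfl⟩
    exact hr ψ (hTS hψ)
  · rintro q ⟨hqX, hq, hqU⟩
    have hqa : a + e.symm (e (q - a)) = q := by simp
    obtain ⟨ψ, hψ, x, hx, hxq⟩ := hq ((hiff _ (by rw [hqa]; exact hqU)).2 (by rw [hqa]; exact hqX))
    refine mem_iUnion₂.2 ⟨_, ⟨ψ, hψ, rfl⟩, x, hx, ?_⟩
    simp only [hxq, hqa]

lemma cov_all (hX : ∀ p : EuclideanSpace ℝ (Fin n),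
    ∃ U : Set (EuclideanSpace ℝ (Fin n)), IsOpen U ∧ p ∈ U ∧
      ∃ (k : ℕ) (f : Fin k → EuclideanSpace ℝ (Fin n) → ℝ),
        (∀ i, AnalyticOn ℝ (f i) U) ∧
        X ∩ U = {q ∈ U | ∀ i, f i q = 0}) (hc : IsCompact X) : Cov (Fin n → ℝ) X X := by
  refine hc.induction_on (p := fun s => Cov (Fin n → ℝ) X s) ?_ ?_ ?_ ?_
  · exact ⟨∅, finite_empty, by simp, by simp⟩
  · rintro s t hst ⟨T, h1, h2, h3⟩
    exact ⟨T, h1, h2, hst.trans h3⟩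
  · rintro s t ⟨T, h1, h2, h3⟩ ⟨T', g1, g2, g3⟩
    refine ⟨T ∪ T', h1.union g1, ?_, ?_⟩
    · rintro c (hc | hc)
      · exact h2 c hc
      · exact g2 c hc
    · rw [biUnion_union]
      exact union_subset_union h3 g3
  · intro a _
    obtain ⟨U, hU, haU, k, f, hf, hXU⟩ := hX a
    obtain ⟨t, ht, hcov⟩ := cov_local hU haU hf hXU
    exact ⟨X ∩ t, inter_mem self_mem_nhdsWithin (mem_nhdsWithin_of_mem_nhds ht), hcov⟩

end Charts

section Final
variable {E : Type*} [NormedAddCommGroup E] [NormedSpace ℝ E] {X : Set E}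

lemma J.nn {p q : E} {L : ℝ} (h : J X p q L) : J X p q |L| := h.mono (le_abs_self L)

lemma Q.near (hQ : Q X (X ×ˢ X)) : ∃ δ B : ℝ, 0 < δ ∧ 0 ≤ B ∧ ∀ p ∈ X, ∀ q ∈ X,
    ‖p - q‖ < δ → J X p q B := by
  obtain ⟨δ, C, ν, h1, h2, h3, h4, h5⟩ := hQ
  refine ⟨δ, C, h1, h3, fun p hp q hq hd => (h5 p q ⟨hp, hq⟩ hd).mono ?_⟩
  have : ‖p - q‖ ^ (1 / (ν : ℝ)) ≤ 1 :=
    Real.rpow_le_one (norm_nonneg _) (hd.le.trans h2) (by positivity)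
  nlinarith

lemma joinable (hQ : Q X (X ×ˢ X)) {p q : E} (h : q ∈ connectedComponentIn X p) :
    ∃ L, J X p q L := by
  have hp : p ∈ X := by
    by_contra hp
    rw [connectedComponentIn_eq_empty hp] at h
    exact h
  obtain ⟨δ, B, hδ, hB, hn⟩ := hQ.near
  refine isPreconnected_connectedComponentIn.induction₂ (fun p q => ∃ L, J X p q L) ?_ ?_ ?_
    (mem_connectedComponentIn hp) h
  · intro x hx
    have : Metric.ball x δ ∈ 𝓝[connectedComponentIn X p] x :=
      mem_nhdsWithin_of_mem_nhds (Metric.ball_mem_nhds x hδ)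
    filter_upwards [this, self_mem_nhdsWithin] with y hy hy'
    refine ⟨B, hn x (connectedComponentIn_subset _ _ hx) y (connectedComponentIn_subset _ _ hy') ?_⟩
    rwa [Metric.mem_ball, dist_comm, dist_eq_norm] at hy
  · rintro x y z _ _ _ ⟨L, hL⟩ ⟨L', hL'⟩
    exact ⟨_, J.trans (abs_nonneg _) (abs_nonneg _) hL.nn hL'.nn⟩
  · rintro x y _ _ ⟨L, hL⟩
    exact ⟨L, hL.symm⟩

lemma bounded_length (hc : IsCompact X) (hQ : Q X (X ×ˢ X)) :
    ∃ L₀, 0 ≤ L₀ ∧ ∀ p ∈ X, ∀ q ∈ X, (∃ L, J X p q L) → J X p q L₀ := by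
  obtain ⟨δ, B, hδ, hB, hn⟩ := hQ.near
  have key : ∃ L₀, 0 ≤ L₀ ∧ ∀ z ∈ X ×ˢ X, (∃ L, J X z.1 z.2 L) → J X z.1 z.2 L₀ := by
    refine (hc.prod hc).induction_on (p := fun s => ∃ L₀, 0 ≤ L₀ ∧ ∀ z ∈ s,
      (∃ L, J X z.1 z.2 L) → J X z.1 z.2 L₀) ?_ ?_ ?_ ?_
    · exact ⟨0, le_rfl, by simp⟩
    · rintro s t hst ⟨L₀, h1, h2⟩
      exact ⟨L₀, h1, fun z hz => h2 z (hst hz)⟩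
    · rintro s t ⟨L, h1, h2⟩ ⟨L', g1, g2⟩
      refine ⟨L + L', by positivity, ?_⟩
      rintro z (hz | hz) hj
      · exact (h2 z hz hj).mono (by linarith)
      · exact (g2 z hz hj).mono (by linarith)
    · rintro ⟨p₀, q₀⟩ ⟨hp₀, hq₀⟩
      have hnb : (X ×ˢ X) ∩ (Metric.ball p₀ δ ×ˢ Metric.ball q₀ δ) ∈ 𝓝[X ×ˢ X] (p₀, q₀) :=
        inter_mem self_mem_nhdsWithin (mem_nhdsWithin_of_mem_nhds
          (prod_mem_nhds (Metric.ball_mem_nhds _ hδ) (Metric.ball_mem_nhds _ hδ)))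
      by_cases hj : ∃ L, J X p₀ q₀ L
      · obtain ⟨L, hL⟩ := hj
        refine ⟨_, hnb, B + |L| + B, by positivity, ?_⟩
        rintro ⟨p, q⟩ ⟨⟨hp, hq⟩, hpb, hqb⟩ -
        have j1 := hn p hp p₀ hp₀ (by simpa [dist_eq_norm] using hpb)
        have j2 := (hn q hq q₀ hq₀ (by simpa [dist_eq_norm] using hqb)).symm
        exact J.trans (by positivity) hB (J.trans hB (abs_nonneg _) j1 hL.nn) j2
      · refine ⟨_, hnb, 0, le_rfl, ?_⟩
        rintro ⟨p, q⟩ ⟨⟨hp, hq⟩, hpb, hqb⟩ ⟨L, hL⟩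
        have j1 := (hn p hp p₀ hp₀ (by simpa [dist_eq_norm] using hpb)).symm
        have j2 := hn q hq q₀ hq₀ (by simpa [dist_eq_norm] using hqb)
        exact absurd ⟨_, J.trans (by positivity) hB (J.trans hB (abs_nonneg _) j1 hL.nn) j2⟩ hj
  obtain ⟨L₀, h1, h2⟩ := key
  exact ⟨L₀, h1, fun p hp q hq => h2 (p, q) ⟨hp, hq⟩⟩

theorem final (hc : IsCompact X) (hQ : Q X (X ×ˢ X)) :
    ∃ (ν : ℕ) (C : ℝ), 0 < ν ∧ 0 < C ∧ ∀ p q : E, q ∈ connectedComponentIn X p →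
      J X p q (C * ‖p - q‖ ^ (1 / (ν : ℝ))) := by
  obtain ⟨L₀, hL₀, hb⟩ := bounded_length hc hQ
  have hj := fun p q => joinable (p := p) (q := q) hQ
  obtain ⟨δ, C, ν, h1, h2, h3, h4, h5⟩ := hQ
  have hδν : 0 < δ ^ (1 / (ν : ℝ)) := Real.rpow_pos_of_pos h1 _
  refine ⟨ν, C + L₀ / δ ^ (1 / (ν : ℝ)) + 1, h4, by positivity, fun p q h => ?_⟩
  obtain ⟨L, hL⟩ := hj p q h
  rcases lt_or_ge ‖p - q‖ δ with hd | hd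
  · refine (h5 p q ⟨hL.left, hL.right⟩ hd).mono ?_
    have : 0 ≤ L₀ / δ ^ (1 / (ν : ℝ)) := by positivity
    gcongr
    linarith
  · refine (hb p hL.left q hL.right ⟨L, hL⟩).mono ?_
    have hle : δ ^ (1 / (ν : ℝ)) ≤ ‖p - q‖ ^ (1 / (ν : ℝ)) :=
      Real.rpow_le_rpow h1.le hd (by positivity)
    calc L₀ = L₀ / δ ^ (1 / (ν : ℝ)) * δ ^ (1 / (ν : ℝ)) := by field_simp
      _ ≤ (C + L₀ / δ ^ (1 / (ν : ℝ)) + 1) * ‖p - q‖ ^ (1 / (ν : ℝ)) := by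
        gcongr
        linarith

end Final
end WR

/-- **Whitney regularity for compact analytic sets, componentwise.**
Let `X` be a compact analytic subset of `ℝⁿ`. Then there exist a positive integer `ν`
and a constant `C > 0` such that any two points `p, q` in the same connected component
of `X` can be joined by a continuous path in `X` of length (total variation) at most
`C · ‖p − q‖^(1/ν)`. -/
theorem whitney_regularity_components
    (n : ℕ) (X : Set (EuclideanSpace ℝ (Fin n)))
    (hX : IsAnalyticSubset X) (hcomp : IsCompact X) :
    ∃ (ν : ℕ) (C : ℝ), 0 < ν ∧ 0 < C ∧
      ∀ p q : EuclideanSpace ℝ (Fin n),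
        q ∈ connectedComponentIn X p →
        ∃ γ : ℝ → EuclideanSpace ℝ (Fin n),
          ContinuousOn γ (Set.Icc 0 1) ∧
          γ 0 = p ∧ γ 1 = q ∧
          γ '' Set.Icc 0 1 ⊆ X ∧
          eVariationOn γ (Set.Icc 0 1) ≤
            ENNReal.ofReal (C * ‖p - q‖ ^ (1 / (ν : ℝ))) := by
  exact WR.final hcomp (WR.cov_all hX hcomp).Q
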